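/- arXiv:1901.10180 — 3 statements merged into one kernel-verified Lean document; each statement's English description precedes it below -/
import Mathlib

section
/- Let G be a connected graph on n ≥ 2 vertices with minimum degree δ, second minimum degree δ′, and diameter d. Set S = dn − d(d−1)/2 − 1 − δ(d−1) and S′ = dn − d(d−1)/2 − 1 − δ′(d−1). Then μ_α(G) ≤ (1/2)(α(2dn − 2 − (d−1)(d+δ+δ′)) + sqrt(α²(2dn − 2 − (d−1)(d+δ+δ′))² − 4(2α−1)SS′)), with equality if and only if G is regular with diameter at most 2. -/
open Finset Matrix

namespace DistAlpha

variable {V : Type*} [Fintype V] [DecidableEq V]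

/-- The distance matrix of a graph, with real entries. -/
noncomputable def distMatrix (G : SimpleGraph V) : Matrix V V ℝ :=
  fun u v => (G.dist u v : ℝ)

/-- The transmission of a vertex: the sum of distances to all vertices. -/
noncomputable def transmission (G : SimpleGraph V) (u : V) : ℝ :=
  ∑ v, (G.dist u v : ℝ)

/-- The matrix `D_α = α T + (1-α) D`. -/
noncomputable def Dalpha (G : SimpleGraph V) (α : ℝ) : Matrix V V ℝ :=
  α • Matrix.diagonal (transmission G) + (1 - α) • distMatrix G

/-- The distance α-spectral radius: the largest (real) eigenvalue of `D_α`. -/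
noncomputable def muAlpha (G : SimpleGraph V) (α : ℝ) : ℝ :=
  sSup (spectrum ℝ (Dalpha G α))

/-- The transmission of a graph: sum of distances over unordered pairs. -/
noncomputable def sigma (G : SimpleGraph V) : ℝ :=
  (∑ u, ∑ v, (G.dist u v : ℝ)) / 2

/-- A graph is transmission regular if all vertex transmissions are equal. -/
def TransmissionRegular (G : SimpleGraph V) : Prop :=
  ∀ u v : V, transmission G u = transmission G v

/-- Collatz–Wielandt bound: a real eigenvalue of an entrywise nonnegative matrix is at most `β`
as soon as some positive vector `y` satisfies `A y ≤ β y`; if the eigenvalue is `β` itself and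
the off-diagonal entries are positive, then `A y = β y`. -/
theorem mem_spectrum_le_of_mulVec_le {A : Matrix V V ℝ} (hA : ∀ i j, 0 ≤ A i j) {y : V → ℝ}
    (hy : ∀ i, 0 < y i) {β μ : ℝ} (hAy : ∀ i, (A *ᵥ y) i ≤ β * y i) (hμ : μ ∈ spectrum ℝ A) :
    μ ≤ β ∧ (μ = β → (∀ i j, i ≠ j → 0 < A i j) → A *ᵥ y = β • y) := by
  rw [← Matrix.spectrum_toLin', ← Module.End.hasEigenvalue_iff_mem_spectrum] at hμ
  obtain ⟨x, hx⟩ := hμ.exists_hasEigenvector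
  have hAx : A *ᵥ x = μ • x := by simpa using hx.apply_eq_smul
  obtain ⟨k, hk⟩ : ∃ k, x k ≠ 0 := Function.ne_iff.mp hx.2
  have : Nonempty V := ⟨k⟩
  obtain ⟨i, hi⟩ := Finite.exists_max fun j => |x j| / y j
  set m := |x i| / y i with hm
  have hm0 : 0 < m := lt_of_lt_of_le (div_pos (abs_pos.mpr hk) (hy k)) (hi k)
  have hxm : ∀ j, |x j| ≤ m * y j := fun j => (div_le_iff₀ (hy j)).mp (hi j)
  have hrow : ∀ j, μ * |x j| ≤ ∑ l, A j l * |x l| := by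
    intro j
    calc μ * |x j| ≤ |μ| * |x j| := by gcongr; exact le_abs_self μ
      _ = |(A *ᵥ x) j| := by rw [hAx]; simp [abs_mul]
      _ ≤ ∑ l, |A j l * x l| := Finset.abs_sum_le_sum_abs _ _
      _ = ∑ l, A j l * |x l| := by
        refine Finset.sum_congr rfl fun l _ => ?_
        rw [abs_mul, abs_of_nonneg (hA j l)]
  have hmul : ∀ j, ∑ l, A j l * (m * y l) = m * (A *ᵥ y) j := by
    intro j
    rw [Matrix.mulVec, dotProduct, Finset.mul_sum]
    exact Finset.sum_congr rfl fun l _ => by ring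
  have hle : ∀ j, ∑ l, A j l * |x l| ≤ m * (A *ᵥ y) j := by
    intro j
    rw [← hmul]
    exact Finset.sum_le_sum fun l _ => mul_le_mul_of_nonneg_left (hxm l) (hA j l)
  have hxi : |x i| = m * y i := by rw [hm, div_mul_cancel₀ _ (hy i).ne']
  have hup : ∀ j, m * (A *ᵥ y) j ≤ β * (m * y j) := fun j => by
    have := mul_le_mul_of_nonneg_left (hAy j) hm0.le
    linarith
  refine ⟨?_, ?_⟩
  · have h := (hrow i).trans ((hle i).trans (hup i))
    rw [hxi] at h
    exact le_of_mul_le_mul_right h (mul_pos hm0 (hy i))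
  · rintro rfl hpos
    have hsum : ∑ l, A i l * |x l| = ∑ l, A i l * (m * y l) := by
      have h1 := hrow i
      have h2 := hup i
      rw [hxi] at h1
      exact le_antisymm ((hle i).trans_eq (hmul i).symm) (by rw [hmul]; linarith)
    have heq := (Finset.sum_eq_sum_iff_of_le fun l _ =>
      mul_le_mul_of_nonneg_left (hxm l) (hA i l)).mp hsum
    have hall : ∀ j, |x j| = m * y j := by
      intro j
      by_cases hij : i = j
      · rw [← hij, hxi]
      · exact mul_left_cancel₀ (hpos i j hij).ne' (heq j (Finset.mem_univ j))
    ext j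
    refine le_antisymm (hAy j) (le_of_mul_le_mul_left ?_ hm0)
    have h := (hrow j).trans (hle j)
    rw [hall] at h
    simp only [Pi.smul_apply, smul_eq_mul]
    linarith

/-- Every distance `j ≤ dist u w` is realised on a geodesic from `u` to `w`. -/
theorem exists_dist_eq {W : Type*} {G : SimpleGraph W} (hG : G.Connected) (u w : W) {j : ℕ}
    (hj : j ≤ G.dist u w) : ∃ v, G.dist u v = j ∧ j + G.dist v w = G.dist u w := by
  induction hm : G.dist u w generalizing w with
  | zero => exact ⟨u, by simp; omega, by omega⟩
  | succ m ih =>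
    rcases hj.eq_or_lt with rfl | hlt
    · exact ⟨w, rfl, by simpa using hm⟩
    · obtain ⟨p, hp⟩ := hG.exists_walk_length_eq_dist u w
      have h1 : G.dist u p.penultimate ≤ m := by
        have := SimpleGraph.dist_le p.dropLast
        simp at this
        omega
      have hadj : G.Adj p.penultimate w := p.adj_penultimate (by
        rw [← SimpleGraph.Walk.length_eq_zero_iff]; omega)
      have h2 := hG.dist_triangle (u := u) (v := p.penultimate) (w := w)
      rw [SimpleGraph.dist_eq_one_iff_adj.mpr hadj] at h2
      obtain ⟨v, hv, hvw⟩ := ih p.penultimate (by omega) (by omega)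
      have h3 := hG.dist_triangle (u := u) (v := v) (w := w)
      have h4 := hG.dist_triangle (u := v) (v := p.penultimate) (w := w)
      rw [SimpleGraph.dist_eq_one_iff_adj.mpr hadj] at h4
      exact ⟨v, hv, by omega⟩

/-- The number of vertices at distance at least `2` and at most `k` from `u`. -/
noncomputable def shellCard (G : SimpleGraph V) (u : V) (k : ℕ) : ℕ :=
  #{v | 2 ≤ G.dist u v ∧ G.dist u v ≤ k}

theorem le_shellCard {W : Type*} [Fintype W] {G : SimpleGraph W} (hG : G.Connected) {d : ℕ}
    (hdex : ∃ u v, G.dist u v = d) (u : W) {k : ℕ} (hkd : k < d) :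
    k - 1 ≤ shellCard G u k := by
  rw [shellCard]
  by_cases hk : ∃ w, k ≤ G.dist u w
  · obtain ⟨w, hw⟩ := hk
    have hsub : Finset.Icc 2 k ⊆
        ({v | 2 ≤ G.dist u v ∧ G.dist u v ≤ k} : Finset W).image (G.dist u) := by
      intro j hj
      rw [Finset.mem_Icc] at hj
      obtain ⟨v, hv, -⟩ := exists_dist_eq hG u w (hj.2.trans hw)
      exact Finset.mem_image.mpr ⟨v, by simp; omega, hv⟩
    have := (Finset.card_le_card hsub).trans Finset.card_image_le
    rw [Nat.card_Icc] at this
    omega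
  · push Not at hk
    obtain ⟨p, q, hpq⟩ := hdex
    have hsub : Finset.range (d + 1) \ Finset.Icc (G.dist p u - 1) (G.dist p u + 1) ⊆
        ({v | 2 ≤ G.dist u v ∧ G.dist u v ≤ k} : Finset W).image (G.dist p) := by
      intro j hj
      rw [Finset.mem_sdiff, Finset.mem_range, Finset.mem_Icc] at hj
      obtain ⟨v, hv, -⟩ := exists_dist_eq hG p q (j := j) (by omega)
      have h1 := hG.dist_triangle (u := p) (v := u) (w := v)
      have h2 := hG.dist_triangle (u := p) (v := v) (w := u)
      rw [SimpleGraph.dist_comm (u := v)] at h2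
      have h3 := hk v
      exact Finset.mem_image.mpr ⟨v, by simp; omega, hv⟩
    have h1 := (Finset.card_le_card hsub).trans Finset.card_image_le
    have h2 := Finset.le_card_sdiff (Finset.Icc (G.dist p u - 1) (G.dist p u + 1))
      (Finset.range (d + 1))
    rw [Finset.card_range, Nat.card_Icc] at h2
    omega

/-- The upper bound for the transmission of a vertex of degree `r` in a connected graph on `n`
vertices with diameter `d`. -/
noncomputable def transBound (n d r : ℝ) : ℝ :=
  d * n - d * (d - 1) / 2 - 1 - r * (d - 1)

theorem transBound_sub_transmission {G : SimpleGraph V} [DecidableRel G.Adj]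
    (hG : G.Connected) {d : ℕ} (hd : 1 ≤ d) (hdub : ∀ u v, G.dist u v ≤ d) (u : V) :
    transBound (Fintype.card V) d (G.degree u) - transmission G u =
      ∑ k ∈ Finset.Ico 2 d, ((shellCard G u k : ℝ) - (k - 1)) := by
  have hpt : ∀ v, (d : ℝ) - G.dist u v = (if v = u then (d : ℝ) else 0) +
      (if G.Adj u v then (d : ℝ) - 1 else 0) +
      ∑ k ∈ Finset.Ico 2 d, if 2 ≤ G.dist u v ∧ G.dist u v ≤ k then (1 : ℝ) else 0 := by
    intro v
    rw [Finset.sum_boole]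
    by_cases hvu : v = u
    · subst hvu; simp
    by_cases hadj : G.Adj u v
    · simp [hvu, hadj, SimpleGraph.dist_eq_one_iff_adj.mpr hadj]
    · have h0 : G.dist u v ≠ 0 := by
        rw [Ne, hG.dist_eq_zero_iff]; exact fun h => hvu h.symm
      have h1 : G.dist u v ≠ 1 := by rwa [Ne, SimpleGraph.dist_eq_one_iff_adj]
      have h2 : 2 ≤ G.dist u v := by omega
      have hfil : (Finset.Ico 2 d).filter (fun k => 2 ≤ G.dist u v ∧ G.dist u v ≤ k) =
          Finset.Ico (G.dist u v) d := by
        ext k; simp; omega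
      rw [hfil, Nat.card_Ico, Nat.cast_sub (hdub u v)]
      simp [hvu, hadj]
  have hsum := Finset.sum_congr (rfl : (Finset.univ : Finset V) = _) fun v _ => hpt v
  rw [Finset.sum_add_distrib, Finset.sum_add_distrib, Finset.sum_comm,
    Finset.sum_sub_distrib] at hsum
  have hdeg : ∑ v, (if G.Adj u v then (d : ℝ) - 1 else 0) = G.degree u * ((d : ℝ) - 1) := by
    rw [← Finset.sum_filter, Finset.sum_const, nsmul_eq_mul, ← G.card_neighborFinset_eq_degree,
      G.neighborFinset_eq_filter]
  have hgauss : ∀ m : ℕ, ∑ k ∈ Finset.Ico 2 (m + 1), ((k : ℝ) - 1) = (m : ℝ) * (m - 1) / 2 := by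
    intro m
    induction m with
    | zero => simp
    | succ m ih =>
      rcases m with _ | m
      · simp
      · rw [Finset.sum_Ico_succ_top (by omega), ih]; push_cast; ring
  obtain ⟨m, rfl⟩ : ∃ m, d = m + 1 := ⟨d - 1, by omega⟩
  rw [hdeg] at hsum
  simp only [Finset.sum_boole, Finset.sum_const, Finset.card_univ, nsmul_eq_mul,
    Finset.sum_ite_eq', Finset.mem_univ, if_true] at hsum
  rw [Finset.sum_sub_distrib, hgauss, transBound, transmission]
  simp only [shellCard]
  push_cast at hsum ⊢
  linarith

theorem transmission_le_transBound {G : SimpleGraph V} [DecidableRel G.Adj]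
    (hG : G.Connected) {d : ℕ} (hd : 1 ≤ d) (hdub : ∀ u v, G.dist u v ≤ d)
    (hdex : ∃ u v, G.dist u v = d) (u : V) :
    transmission G u ≤ transBound (Fintype.card V) d (G.degree u) := by
  rw [← sub_nonneg, transBound_sub_transmission hG hd hdub]
  refine Finset.sum_nonneg fun k hk => ?_
  rw [Finset.mem_Ico] at hk
  have h : ((k - 1 : ℕ) : ℝ) ≤ shellCard G u k := by exact_mod_cast le_shellCard hG hdex u hk.2
  rw [Nat.cast_sub (by omega)] at h
  push_cast at h
  linarith

/-- A regular connected graph attaining the transmission bound at every vertex has diameter at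
most `2`. -/
theorem diam_le_two_of_regular {G : SimpleGraph V} [DecidableRel G.Adj]
    (hG : G.Connected) {d : ℕ} (hdub : ∀ u v, G.dist u v ≤ d)
    (hdex : ∃ u v, G.dist u v = d) (hreg : ∀ w z, G.degree w = G.degree z)
    (htr : ∀ u, transmission G u = transBound (Fintype.card V) d (G.degree u)) : d ≤ 2 := by
  by_contra! hd
  have hshell : ∀ u, shellCard G u 2 = 1 := by
    intro u
    have h0 := transBound_sub_transmission hG (by omega) hdub u
    rw [htr, sub_self, eq_comm, Finset.sum_eq_zero_iff_of_nonneg] at h0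
    · have := h0 2 (by simp; omega)
      push_cast at this
      have h : (shellCard G u 2 : ℝ) = 1 := by linarith
      exact_mod_cast h
    · intro k hk
      rw [Finset.mem_Ico] at hk
      have h : ((k - 1 : ℕ) : ℝ) ≤ shellCard G u k := by
        exact_mod_cast le_shellCard hG hdex u hk.2
      rw [Nat.cast_sub (by omega)] at h
      push_cast at h
      linarith
  obtain ⟨p, q, hpq⟩ := hdex
  obtain ⟨c, hc, -⟩ := exists_dist_eq hG p q (j := 3) (by omega)
  obtain ⟨a, hpa, hac⟩ := exists_dist_eq hG p c (j := 1) (by omega)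
  obtain ⟨b, hab, hbc⟩ := exists_dist_eq hG a c (j := 1) (by omega)
  have hpb := hG.dist_triangle (u := p) (v := b) (w := c)
  have huniq : ∀ v, G.dist a v = 2 → v = c := by
    intro v hv
    exact Finset.card_le_one.mp (hshell a).le v (by simp [hv]) c (by simp; omega)
  have hsub : insert b (insert p ((G.neighborFinset p).erase a)) ⊆ G.neighborFinset a := by
    intro v hv
    rw [SimpleGraph.mem_neighborFinset, ← SimpleGraph.dist_eq_one_iff_adj]
    simp only [Finset.mem_insert, Finset.mem_erase, SimpleGraph.mem_neighborFinset] at hv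
    rcases hv with rfl | rfl | ⟨hva, hpv⟩
    · exact hab
    · rwa [SimpleGraph.dist_comm]
    · rw [← SimpleGraph.dist_eq_one_iff_adj] at hpv
      have h1 := hG.dist_triangle (u := a) (v := p) (w := v)
      rw [SimpleGraph.dist_comm (u := a) (v := p)] at h1
      have h2 := hG.pos_dist_of_ne (Ne.symm hva)
      have h3 : G.dist a v ≠ 2 := fun h => by
        rw [huniq v h] at hpv
        omega
      omega
  have hcard := Finset.card_le_card hsub
  have hb : b ∉ insert p ((G.neighborFinset p).erase a) := by
    simp only [Finset.mem_insert, Finset.mem_erase, SimpleGraph.mem_neighborFinset,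
      ← SimpleGraph.dist_eq_one_iff_adj]
    rintro (rfl | ⟨-, h⟩)
    · rw [SimpleGraph.dist_self] at hpb
      omega
    · omega
  have hamem : a ∈ G.neighborFinset p := by
    rw [SimpleGraph.mem_neighborFinset, ← SimpleGraph.dist_eq_one_iff_adj]
    exact hpa
  rw [Finset.card_insert_of_notMem hb, Finset.card_insert_of_notMem (by simp),
    Finset.card_erase_of_mem hamem, G.card_neighborFinset_eq_degree,
    G.card_neighborFinset_eq_degree, hreg a p] at hcard
  omega

/-- The larger root of `t ^ 2 - α (P + Q) t + (2 α - 1) P Q`. -/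
noncomputable def largerRoot (α P Q : ℝ) : ℝ :=
  (α * (P + Q) + Real.sqrt (α ^ 2 * (P + Q) ^ 2 - 4 * (2 * α - 1) * P * Q)) / 2

theorem largerRoot_spec {α P Q : ℝ} (hα1 : α < 1) (hQ : 0 < Q) (hQP : Q ≤ P) :
    Q ≤ largerRoot α P Q ∧
      (largerRoot α P Q - α * P) * (largerRoot α P Q - α * Q) = (1 - α) ^ 2 * P * Q := by
  have h1 : 0 ≤ (1 - α) * Q * (P - Q) :=
    mul_nonneg (mul_nonneg (by linarith) hQ.le) (by linarith)
  have h2 : (2 * Q - α * (P + Q)) ^ 2 ≤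
      α ^ 2 * (P + Q) ^ 2 - 4 * (2 * α - 1) * P * Q := by linarith
  have h3 := Real.le_sqrt_of_sq_le h2
  have h4 := Real.sq_sqrt ((sq_nonneg _).trans h2)
  refine ⟨by rw [largerRoot]; linarith, ?_⟩
  rw [largerRoot]
  linear_combination h4 / 4

theorem largerRoot_self {α P : ℝ} (hα1 : α < 1) (hP : 0 ≤ P) : largerRoot α P P = P := by
  rw [largerRoot, show α ^ 2 * (P + P) ^ 2 - 4 * (2 * α - 1) * P * P = (2 * (1 - α) * P) ^ 2 by
    ring, Real.sqrt_sq (mul_nonneg (by linarith) hP)]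
  ring

theorem Dalpha_mulVec (G : SimpleGraph V) (α : ℝ) (y : V → ℝ) (i : V) :
    (Dalpha G α *ᵥ y) i =
      α * transmission G i * y i + (1 - α) * ∑ j, (G.dist i j : ℝ) * y j := by
  rw [Dalpha, Matrix.add_mulVec, Matrix.smul_mulVec, Matrix.smul_mulVec, Pi.add_apply,
    Pi.smul_apply, Pi.smul_apply, Matrix.mulVec_diagonal]
  simp only [Matrix.mulVec, dotProduct, distMatrix, smul_eq_mul, mul_assoc]

theorem transmission_nonneg {W : Type*} [Fintype W] (G : SimpleGraph W) (u : W) :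
    0 ≤ transmission G u :=
  Finset.sum_nonneg fun _ _ => Nat.cast_nonneg _

theorem Dalpha_nonneg (G : SimpleGraph V) {α : ℝ} (hα0 : 0 ≤ α) (hα1 : α ≤ 1) (i j : V) :
    0 ≤ Dalpha G α i j := by
  have h1 : 0 ≤ 1 - α := by linarith
  have h2 := transmission_nonneg G i
  rw [Dalpha, Matrix.add_apply, Matrix.smul_apply, Matrix.smul_apply, Matrix.diagonal_apply]
  simp only [distMatrix, smul_eq_mul]
  split_ifs <;> positivity

theorem Dalpha_pos {G : SimpleGraph V} (hG : G.Connected) {α : ℝ} (hα1 : α < 1) {i j : V}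
    (hij : i ≠ j) : 0 < Dalpha G α i j := by
  have h1 : 0 < 1 - α := by linarith
  have h2 : (0 : ℝ) < G.dist i j := by exact_mod_cast hG.pos_dist_of_ne hij
  rw [Dalpha, Matrix.add_apply, Matrix.smul_apply, Matrix.smul_apply,
    Matrix.diagonal_apply_ne _ hij]
  simp only [distMatrix, smul_eq_mul, mul_zero, zero_add]
  positivity

theorem transmission_pos {W : Type*} [Fintype W] {G : SimpleGraph W} (hG : G.Connected)
    (hn : 2 ≤ Fintype.card W)
    (u : W) : 0 < transmission G u := by
  have : Nontrivial W := Fintype.one_lt_card_iff_nontrivial.mp hn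
  obtain ⟨v, hv⟩ := exists_ne u
  exact Finset.sum_pos' (fun _ _ => Nat.cast_nonneg _)
    ⟨v, Finset.mem_univ v, by exact_mod_cast hG.pos_dist_of_ne hv.symm⟩

theorem sum_dist_mul_ite (G : SimpleGraph V) (u j : V) (b c : ℝ) :
    ∑ k, (G.dist j k : ℝ) * (if k = u then c else b) =
      transmission G j * b + (c - b) * G.dist j u := by
  have : ∀ k, (G.dist j k : ℝ) * (if k = u then c else b) =
      G.dist j k * b + if k = u then (c - b) * G.dist j u else 0 := by
    intro k
    split_ifs with h
    · subst h; ring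
    · ring
  simp [this, Finset.sum_add_distrib, ← Finset.sum_mul, transmission]

theorem dist_le_transmission {W : Type*} [Fintype W] (G : SimpleGraph W) (u v : W) :
    (G.dist u v : ℝ) ≤ transmission G u :=
  Finset.single_le_sum (f := fun w => (G.dist u w : ℝ)) (fun _ _ => Nat.cast_nonneg _)
    (Finset.mem_univ v)

/-- Two vertices at a distance equal to the transmission of one of them are the only ones. -/
theorem transmission_eq_of_dist_eq_transmission {G : SimpleGraph V} (hG : G.Connected) {u v : V}
    (h : transmission G v = G.dist v u) : transmission G u = transmission G v := by
  have hzero : ∀ w, w ≠ u → w = v := by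
    intro w hw
    have h1 := Finset.add_le_sum (f := fun w => (G.dist v w : ℝ)) (s := Finset.univ)
      (fun _ _ => Nat.cast_nonneg _) (Finset.mem_univ w) (Finset.mem_univ u) hw
    rw [transmission] at h
    have h2 : (G.dist v w : ℝ) ≤ 0 := by linarith
    have h3 : G.dist v w = 0 := by exact_mod_cast le_antisymm h2 (Nat.cast_nonneg _)
    exact (hG.dist_eq_zero_iff.mp h3).symm
  rw [h, SimpleGraph.dist_comm, transmission]
  refine Finset.sum_eq_single v (fun w _ hw => ?_) (fun hv => absurd (Finset.mem_univ v) hv)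
  have : w = u := by
    by_contra hwu
    exact hw (hzero w hwu)
  simp [this]

/-- If all vertices but `u` have transmission at most `Q`, and `u` has transmission at most
`P ≥ Q`, then `μ_α` is at most the larger root of
`(t - α P) (t - α Q) = (1 - α) ^ 2 P Q`, and equality forces constant transmission `P = Q`. -/
theorem muAlpha_le_largerRoot {G : SimpleGraph V} (hG : G.Connected)
    (hn : 2 ≤ Fintype.card V) {α : ℝ} (hα0 : 0 ≤ α) (hα1 : α < 1) {P Q : ℝ} (hQP : Q ≤ P)
    {u : V} (hP : transmission G u ≤ P) (hQ : ∀ w, w ≠ u → transmission G w ≤ Q) :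
    muAlpha G α ≤ largerRoot α P Q ∧
      (muAlpha G α = largerRoot α P Q → P = Q ∧ ∀ w, transmission G w = P) := by
  have : Nontrivial V := Fintype.one_lt_card_iff_nontrivial.mp hn
  obtain ⟨v, hv⟩ := exists_ne u
  have hQ0 : 0 < Q := (transmission_pos hG hn v).trans_le (hQ v hv)
  obtain ⟨hβQ, hroot⟩ := largerRoot_spec hα1 hQ0 hQP
  set β := largerRoot α P Q
  have hα : 0 < 1 - α := by linarith
  have hb : 0 < (1 - α) * Q := mul_pos hα hQ0
  have hbc : (1 - α) * Q ≤ β - α * Q := by linarith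
  have hc : 0 < β - α * Q := by linarith
  have hcoef : 0 < α * ((1 - α) * Q) + (1 - α) * (β - α * Q) :=
    add_pos_of_nonneg_of_pos (by positivity) (by positivity)
  have hcoef' : 0 < α * (β - α * Q) + (1 - α) * ((1 - α) * Q) :=
    add_pos_of_nonneg_of_pos (by positivity) (by positivity)
  set y : V → ℝ := fun w => if w = u then β - α * Q else (1 - α) * Q with hy
  have hrow_u : β * y u - (Dalpha G α *ᵥ y) u =
      (P - transmission G u) * (α * (β - α * Q) + (1 - α) * ((1 - α) * Q)) := by
    rw [Dalpha_mulVec, hy, sum_dist_mul_ite]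
    simp only [if_true, SimpleGraph.dist_self, Nat.cast_zero, mul_zero, add_zero]
    linear_combination hroot
  have hrow : ∀ w, w ≠ u → β * y w - (Dalpha G α *ᵥ y) w =
      (Q - transmission G w) * (α * ((1 - α) * Q) + (1 - α) * (β - α * Q)) +
        (1 - α) * (β - α * Q - (1 - α) * Q) * (transmission G w - G.dist w u) := by
    intro w hw
    rw [Dalpha_mulVec, hy, sum_dist_mul_ite]
    simp only [if_neg hw]
    ring
  have hterm1 : ∀ w, w ≠ u →
      0 ≤ (Q - transmission G w) * (α * ((1 - α) * Q) + (1 - α) * (β - α * Q)) :=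
    fun w hw => mul_nonneg (sub_nonneg.mpr (hQ w hw)) hcoef.le
  have hterm2 : ∀ w, 0 ≤
      (1 - α) * (β - α * Q - (1 - α) * Q) * (transmission G w - G.dist w u) :=
    fun w => mul_nonneg (mul_nonneg hα.le (sub_nonneg.mpr hbc))
      (sub_nonneg.mpr (dist_le_transmission G w u))
  have hypos : ∀ w, 0 < y w := by
    intro w
    rw [hy]
    dsimp only
    split_ifs
    exacts [hc, hb]
  have hAy : ∀ w, (Dalpha G α *ᵥ y) w ≤ β * y w := by
    intro w
    rw [← sub_nonneg]
    by_cases hw : w = u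
    · rw [hw, hrow_u]
      exact mul_nonneg (sub_nonneg.mpr hP) hcoef'.le
    · rw [hrow w hw]
      exact add_nonneg (hterm1 w hw) (hterm2 w)
  have hspec := fun {μ} => mem_spectrum_le_of_mulVec_le (μ := μ)
    (Dalpha_nonneg G hα0 hα1.le) hypos hAy
  have hβ0 : 0 < β := hQ0.trans_le hβQ
  refine ⟨Real.sSup_le (fun μ hμ => (hspec hμ).1) hβ0.le, fun heq => ?_⟩
  have hmem : β ∈ spectrum ℝ (Dalpha G α) := by
    have hne : (spectrum ℝ (Dalpha G α)).Nonempty := by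
      by_contra hemp
      rw [Set.not_nonempty_iff_eq_empty] at hemp
      rw [muAlpha, hemp, Real.sSup_empty] at heq
      exact hβ0.ne heq
    rw [← heq]
    exact hne.csSup_mem (Matrix.finite_spectrum _)
  have htight := (hspec hmem).2 rfl fun i j hij => Dalpha_pos hG hα1 hij
  have htight' : ∀ w, β * y w - (Dalpha G α *ᵥ y) w = 0 := fun w => by rw [htight]; simp
  have hTu : transmission G u = P := by
    have h := htight' u
    rw [hrow_u] at h
    linarith [(mul_eq_zero.mp h).resolve_right hcoef'.ne']
  have hTw : ∀ w, w ≠ u → transmission G w = Q := by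
    intro w hw
    have h := htight' w
    rw [hrow w hw, add_eq_zero_iff_of_nonneg (hterm1 w hw) (hterm2 w)] at h
    linarith [(mul_eq_zero.mp h.1).resolve_right hcoef.ne']
  have hPQ : P = Q := by
    have h := htight' v
    rw [hrow v hv, add_eq_zero_iff_of_nonneg (hterm1 v hv) (hterm2 v)] at h
    rcases mul_eq_zero.mp h.2 with h2 | h2
    · have hβ : β = Q := by linarith [(mul_eq_zero.mp h2).resolve_left hα.ne']
      rw [hβ] at hroot
      have h3 : (1 - α) * Q * (Q - P) = 0 := by linear_combination hroot
      linarith [(mul_eq_zero.mp h3).resolve_left hb.ne']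
    · rw [← hTu, ← hTw v hv]
      exact transmission_eq_of_dist_eq_transmission hG (sub_eq_zero.mp h2)
  refine ⟨hPQ, fun w => ?_⟩
  by_cases hw : w = u
  · rw [hw, hTu]
  · rw [hTw w hw, hPQ]

/-- A constant transmission is an eigenvalue of `D_α`. -/
theorem mem_spectrum_Dalpha {G : SimpleGraph V} [Nonempty V] {α P : ℝ}
    (hT : ∀ w, transmission G w = P) : P ∈ spectrum ℝ (Dalpha G α) := by
  rw [← Matrix.spectrum_toLin', ← Module.End.hasEigenvalue_iff_mem_spectrum]
  refine Module.End.hasEigenvalue_of_hasEigenvector (x := fun _ => 1) ⟨?_, ?_⟩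
  · rw [Module.End.mem_eigenspace_iff]
    ext w
    have hw := hT w
    rw [Matrix.toLin'_apply, Dalpha_mulVec, hw]
    simp only [mul_one, Pi.smul_apply, smul_eq_mul]
    rw [transmission] at hw
    rw [hw]
    ring
  · exact fun h => one_ne_zero (congrFun h (Classical.arbitrary V))

/-- upper bound for `μ_α` in terms of the minimum degree `δ`, the second
minimum degree `δ'` and the diameter `d`, with equality iff `G` is regular with diameter
at most 2. -/
theorem muAlpha_upper_bound_degrees (G : SimpleGraph V) [DecidableRel G.Adj]
    (hG : G.Connected) (hn : 2 ≤ Fintype.card V)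
    (α : ℝ) (hα0 : 0 ≤ α) (hα1 : α < 1) (δ δ' d : ℕ)
    (hdub : ∀ u v, G.dist u v ≤ d) (hdex : ∃ u v, G.dist u v = d)
    (u₀ : V) (hu₀ : G.degree u₀ = δ) (hδ : ∀ w, δ ≤ G.degree w)
    (hδ'exists : ∃ v₀, v₀ ≠ u₀ ∧ G.degree v₀ = δ')
    (hδ' : ∀ w, w ≠ u₀ → δ' ≤ G.degree w) :
    muAlpha G α ≤
      (α * (2 * d * (Fintype.card V : ℝ) - 2 - (d - 1) * (d + δ + δ')) +
        Real.sqrt (α ^ 2 * (2 * d * (Fintype.card V : ℝ) - 2 - (d - 1) * (d + δ + δ')) ^ 2 -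
          4 * (2 * α - 1) *
            (d * (Fintype.card V : ℝ) - d * (d - 1) / 2 - 1 - δ * (d - 1)) *
            (d * (Fintype.card V : ℝ) - d * (d - 1) / 2 - 1 - δ' * (d - 1)))) / 2 ∧
      (muAlpha G α =
        (α * (2 * d * (Fintype.card V : ℝ) - 2 - (d - 1) * (d + δ + δ')) +
          Real.sqrt (α ^ 2 * (2 * d * (Fintype.card V : ℝ) - 2 - (d - 1) * (d + δ + δ')) ^ 2 -
            4 * (2 * α - 1) *
              (d * (Fintype.card V : ℝ) - d * (d - 1) / 2 - 1 - δ * (d - 1)) *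
              (d * (Fintype.card V : ℝ) - d * (d - 1) / 2 - 1 - δ' * (d - 1)))) / 2 ↔
        ((∀ w z : V, G.degree w = G.degree z) ∧ d ≤ 2)) := by
  have hn' : Nontrivial V := Fintype.one_lt_card_iff_nontrivial.mp hn
  obtain ⟨v₀, hv₀, hdv₀⟩ := hδ'exists
  have hd : 1 ≤ d := (hG.pos_dist_of_ne hv₀).trans_le (hdub v₀ u₀)
  have hd1 : (0 : ℝ) ≤ (d : ℝ) - 1 := by
    rw [sub_nonneg]
    exact_mod_cast hd
  have hanti : ∀ {r s : ℕ}, r ≤ s →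
      transBound (Fintype.card V) d s ≤ transBound (Fintype.card V) d r := by
    intro r s hrs
    have : (r : ℝ) * (d - 1) ≤ s * (d - 1) :=
      mul_le_mul_of_nonneg_right (by exact_mod_cast hrs) hd1
    rw [transBound, transBound]
    linarith
  have hT := transmission_le_transBound hG hd hdub hdex
  have hQP := hanti (hdv₀ ▸ hδ v₀)
  have hroot : (α * (2 * d * (Fintype.card V : ℝ) - 2 - (d - 1) * (d + δ + δ')) +
        Real.sqrt (α ^ 2 * (2 * d * (Fintype.card V : ℝ) - 2 - (d - 1) * (d + δ + δ')) ^ 2 -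
          4 * (2 * α - 1) *
            (d * (Fintype.card V : ℝ) - d * (d - 1) / 2 - 1 - δ * (d - 1)) *
            (d * (Fintype.card V : ℝ) - d * (d - 1) / 2 - 1 - δ' * (d - 1)))) / 2 =
      largerRoot α (transBound (Fintype.card V) d δ) (transBound (Fintype.card V) d δ') := by
    have hsum : 2 * d * (Fintype.card V : ℝ) - 2 - (d - 1) * (d + δ + δ') =
        transBound (Fintype.card V) d δ + transBound (Fintype.card V) d δ' := by
      rw [transBound, transBound]
      ring
    rw [hsum, largerRoot]
    rfl
  rw [hroot]
  obtain ⟨hle, hequ⟩ := muAlpha_le_largerRoot hG hn hα0 hα1 hQP (hu₀ ▸ hT u₀)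
    fun w hw => (hT w).trans (hanti (hδ' w hw))
  refine ⟨hle, fun heq => ?_, ?_⟩
  · obtain ⟨hPQ, hconst⟩ := hequ heq
    by_cases hd2 : d ≤ 2
    · refine ⟨fun w z => ?_, hd2⟩
      have hdeg : ∀ w, (G.degree w : ℝ) =
          2 * Fintype.card V - 2 - transBound (Fintype.card V) d δ := by
        intro w
        have h := transBound_sub_transmission hG one_le_two
          (fun u v => (hdub u v).trans hd2) w
        rw [Finset.Ico_self, Finset.sum_empty, hconst, transBound] at h
        push_cast at h
        linarith
      exact_mod_cast (hdeg w).trans (hdeg z).symm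
    · have hd3 : (0 : ℝ) < (d : ℝ) - 1 := by
        rw [sub_pos]
        exact_mod_cast (by omega : 1 < d)
      have hdeg : ∀ w, G.degree w = δ := by
        intro w
        have h := hT w
        rw [hconst, transBound, transBound] at h
        have h1 : (G.degree w : ℝ) ≤ δ := le_of_mul_le_mul_right (by linarith) hd3
        exact le_antisymm (by exact_mod_cast h1) (hδ w)
      have hreg : ∀ w z, G.degree w = G.degree z := fun w z => by rw [hdeg, hdeg]
      exact ⟨hreg, diam_le_two_of_regular hG hdub hdex hreg fun w => by rw [hconst, hdeg]⟩
  · rintro ⟨hreg, hd2⟩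
    have hδδ' : δ' = δ := by rw [← hdv₀, ← hu₀, hreg]
    subst hδδ'
    have hconst : ∀ w, transmission G w = transBound (Fintype.card V) d δ' := by
      intro w
      have h := transBound_sub_transmission hG hd hdub w
      rw [Finset.Ico_eq_empty_of_le hd2, Finset.sum_empty, hreg w v₀, hdv₀] at h
      linarith
    rw [largerRoot_self hα1 (hconst u₀ ▸ transmission_nonneg G u₀)] at hle ⊢
    exact le_antisymm hle
      (le_csSup (Matrix.finite_spectrum _).bddAbove (mem_spectrum_Dalpha hconst))

end DistAlpha
end

section
/- Let G be a unicyclic graph on n ≥ 6 vertices different from S_n⁺ (the star with an extra edge). Then σ(G) ≥ n² − n − 4 > σ(S_n⁺) = n² − 2n. -/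
open Finset Matrix

namespace DistAlpha

variable {V : Type*} [Fintype V] [DecidableEq V]

/-- The graph `Sₙ⁺`: the star on `n` vertices (center `0`) with an extra edge joining the
leaves `1` and `2`. -/
def SnPlus (n : ℕ) : SimpleGraph (Fin n) :=
  SimpleGraph.fromRel (fun u v => u.val = 0 ∨ (u.val = 1 ∧ v.val = 2))

/-- `p` sends each vertex other than `r` to a neighbour that is closer to `r`. -/
def IsParentMap (G : SimpleGraph V) (r : V) (p : V → V) : Prop :=
  ∀ v, v ≠ r → G.Adj (p v) v ∧ G.dist r (p v) + 1 = G.dist r v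

theorem exists_adj_dist_succ {W : Type*} {G : SimpleGraph W} (hconn : G.Connected)
    {r v : W} (hv : v ≠ r) :
    ∃ u, G.Adj u v ∧ G.dist r u + 1 = G.dist r v := by
  obtain ⟨w, hw⟩ := hconn.exists_walk_length_eq_dist v r
  cases w with
  | nil => exact absurd rfl hv
  | cons h q =>
    rename_i u
    refine ⟨u, h.symm, ?_⟩
    have h1 := SimpleGraph.dist_le q
    have h2 := h.symm.diff_dist_adj (u := r)
    rw [SimpleGraph.Walk.length_cons] at hw
    rw [SimpleGraph.dist_comm (u := v)] at hw
    rw [SimpleGraph.dist_comm (u := u)] at h1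
    omega

theorem exists_isParentMap {W : Type*} {G : SimpleGraph W} (hconn : G.Connected) (r : W) :
    ∃ p, IsParentMap G r p := by
  have h : ∀ v, ∃ u, v ≠ r → G.Adj u v ∧ G.dist r u + 1 = G.dist r v := by
    intro v
    by_cases hv : v = r
    · exact ⟨v, fun h => absurd hv h⟩
    · obtain ⟨u, hu⟩ := exists_adj_dist_succ hconn hv
      exact ⟨u, fun _ => hu⟩
  choose p hp using h
  exact ⟨p, hp⟩

/-- A connected graph with as many edges as vertices has exactly one edge outside the spanning tree
given by a parent map. -/
theorem exists_extra_edge {G : SimpleGraph V} [DecidableRel G.Adj]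
    (huni : G.edgeFinset.card = Fintype.card V) {r : V} {p : V → V} (hp : IsParentMap G r p) :
    ∃ x y, G.Adj x y ∧ (x ≠ r → p x ≠ y) ∧ (y ≠ r → p y ≠ x) ∧ ∀ u v, G.Adj u v →
      (p v = u ∧ G.dist r v = G.dist r u + 1) ∨ (p u = v ∧ G.dist r u = G.dist r v + 1) ∨
        (u = x ∧ v = y) ∨ (u = y ∧ v = x) := by
  classical
  set T : Finset (Sym2 V) := (Finset.univ.erase r).image fun v => s(v, p v) with hT
  have hTcard : T.card = Fintype.card V - 1 := by
    rw [hT, Finset.card_image_of_injOn, Finset.card_erase_of_mem (Finset.mem_univ _),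
      Finset.card_univ]
    intro u hu v hv huv
    simp only [Finset.coe_erase, Finset.coe_univ, Set.mem_sdiff, Set.mem_univ,
      Set.mem_singleton_iff, true_and] at hu hv
    rcases Sym2.eq_iff.1 huv with h | h
    · exact h.1
    · have h1 := (hp u hu).2
      have h2 := (hp v hv).2
      rw [h.2] at h1
      rw [← h.1] at h2
      omega
  have hTsub : T ⊆ G.edgeFinset := by
    intro e he
    obtain ⟨v, hv, rfl⟩ := Finset.mem_image.1 he
    rw [SimpleGraph.mem_edgeFinset, SimpleGraph.mem_edgeSet]
    exact (hp v (Finset.ne_of_mem_erase hv)).1.symm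
  have hpos : 0 < Fintype.card V := Fintype.card_pos_iff.2 ⟨r⟩
  have hone : (G.edgeFinset \ T).card = 1 := by
    rw [Finset.card_sdiff_of_subset hTsub]
    omega
  obtain ⟨e, he⟩ := Finset.card_eq_one.1 hone
  induction e with | _ x y
  have hmem : s(x, y) ∈ G.edgeFinset \ T := he ▸ Finset.mem_singleton_self _
  rw [Finset.mem_sdiff, SimpleGraph.mem_edgeFinset, SimpleGraph.mem_edgeSet] at hmem
  have hnot : ∀ v, v ≠ r → s(v, p v) ≠ s(x, y) := fun v hv h =>
    hmem.2 (h ▸ Finset.mem_image_of_mem _ (Finset.mem_erase.2 ⟨hv, Finset.mem_univ _⟩))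
  refine ⟨x, y, hmem.1, fun hx h => hnot x hx (by rw [h]),
    fun hy h => hnot y hy (by rw [h, Sym2.eq_swap]), fun u v huv => ?_⟩
  by_cases hmT : s(u, v) ∈ T
  · obtain ⟨z, hz, hzz⟩ := Finset.mem_image.1 hmT
    have hz := Finset.ne_of_mem_erase hz
    rcases Sym2.eq_iff.1 hzz with h | h
    · obtain ⟨rfl, h⟩ := h
      exact Or.inr (Or.inl ⟨h, h ▸ (hp z hz).2.symm⟩)
    · obtain ⟨rfl, h⟩ := h
      exact Or.inl ⟨h, h ▸ (hp z hz).2.symm⟩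
  · have : s(u, v) ∈ G.edgeFinset \ T := by
      rw [Finset.mem_sdiff, SimpleGraph.mem_edgeFinset, SimpleGraph.mem_edgeSet]
      exact ⟨huv, hmT⟩
    rw [he, Finset.mem_singleton] at this
    exact Or.inr (Or.inr (Sym2.eq_iff.1 this))

theorem eq_or_adj_or_exists_of_dist_le_two {W : Type*} {G : SimpleGraph W} (hconn : G.Connected)
    {u v : W} (h : G.dist u v ≤ 2) : u = v ∨ G.Adj u v ∨ ∃ z, G.Adj u z ∧ G.Adj z v := by
  obtain ⟨w, hw⟩ := hconn.exists_walk_length_eq_dist u v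
  rw [← hw] at h
  match w, h with
  | .nil, _ => exact Or.inl rfl
  | .cons h1 .nil, _ => exact Or.inr (Or.inl h1)
  | .cons h1 (.cons h2 .nil), _ => exact Or.inr (Or.inr ⟨_, h1, h2⟩)
  | .cons _ (.cons _ (.cons _ _)), h => simp only [SimpleGraph.Walk.length_cons] at h; omega

/-- The shapes the extra edge `xy` of a unicyclic graph with parent map `p` rooted at `b` can take
when `w` is within distance two of every vertex of the path `a b c d`. -/
def ExtraEdgeShape {W : Type*} (p : W → W) (a b c d x y w : W) : Prop :=
  (x = w ∧ y = c ∨ x = c ∧ y = w) ∨ (x = w ∧ y = a ∨ x = a ∧ y = w) ∨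
    (p w = b ∧ (x = w ∧ y = d ∨ x = d ∧ y = w)) ∨ (x = d ∧ p y = w ∨ y = d ∧ p x = w) ∨
    ((x = w ∧ p y = a ∨ y = w ∧ p x = a) ∧ p w = c)

theorem extraEdgeShape_of_near {W : Type*} {A : W → W → Prop} {l : W → ℕ} {a b c d x y w : W}
    {p : W → W} (hbc : A b c) (hcd : A c d) (hpd : p d = c)
    (hxy : ∀ u v, A u v → (p v = u ∧ l v = l u + 1) ∨ (p u = v ∧ l u = l v + 1) ∨
      (u = x ∧ v = y) ∨ (u = y ∧ v = x))
    (hwa : w ≠ a) (hwb : w ≠ b) (hwc : w ≠ c) (hwd : w ≠ d)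
    (hx : l x ≤ l y + 1) (hy : l y ≤ l x + 1) (hla : l a = 1) (hlb : l b = 0) (hlc : l c = 1)
    (hnad : ∀ z, A a z → ¬ A z d) (hnd : ¬ A a d) (hdb : d ≠ b) (hld : l d = 2)
    (hpa : p a = b) (hpc : p c = b) (ha : A w a ∨ ∃ z, A w z ∧ A z a) (hb : l w ≤ 2)
    (hc : A w c ∨ ∃ z, A w z ∧ A z c) (hd : A w d ∨ ∃ z, A w z ∧ A z d)
    (hb0 : ∀ v, l v = 0 → v = b) (hl1 : ∀ v, l v = 1 → p v = b) (hsym : ∀ u v, A u v → A v u) :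
    ExtraEdgeShape p a b c d x y w := by
  unfold ExtraEdgeShape
  obtain ha | ⟨z1, ha1, ha2⟩ := ha
  · obtain hd | ⟨z2, hd1, hd2⟩ := hd
    · grind
    · have h1 := hxy _ _ ha
      have h2 := hxy _ _ hd1
      have h3 := hxy _ _ hd2
      obtain hc | ⟨z4, hc1, hc2⟩ := hc
      · have h4 := hxy _ _ hc
        grind
      · have h4 := hxy _ _ hc1
        have h5 := hxy _ _ hc2
        have := hnad z2
        have := hnad z4
        clear hxy hnad hsym
        grind (splits := 30)
  · have h1 := hxy _ _ ha1
    have h2 := hxy _ _ ha2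
    have := hb0 z1
    have := hl1 z1
    have := hl1 w
    obtain hd | ⟨z2, hd1, hd2⟩ := hd
    · have h3 := hxy _ _ hd
      clear hxy hnad hsym hb0 hl1 hc
      grind (splits := 30)
    · have h3 := hxy _ _ hd1
      have h4 := hxy _ _ hd2
      have := hb0 z2
      have h12 : z1 ≠ z2 := by
        rintro rfl
        exact hnad _ (hsym _ _ ha2) hd2
      clear hc
      by_cases hwc : A w c
      · have h5 := hxy _ _ hwc
        clear hxy hnad hsym hb0 hl1
        grind (splits := 30)
      · have : z2 ≠ c := by
          rintro rfl
          exact hwc hd1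
        clear hxy hnad hsym hb0 hl1
        grind (splits := 30)

theorem eq_of_extraEdgeShape {W : Type*} {l : W → ℕ} {a b c d x y w v : W} {p : W → W}
    (hpd : p d = c) (hwa : w ≠ a) (hwb : w ≠ b) (hwc : w ≠ c) (hwd : w ≠ d)
    (hva : v ≠ a) (hvb : v ≠ b) (hvc : v ≠ c) (hvd : v ≠ d)
    (hla : l a = 1) (hlb : l b = 0) (hlc : l c = 1) (hdb : d ≠ b) (hld : l d = 2)
    (hpa : p a = b) (hpc : p c = b) (hac : a ≠ c)
    (hw : ExtraEdgeShape p a b c d x y w) (hv : ExtraEdgeShape p a b c d x y v) : w = v := by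
  unfold ExtraEdgeShape at hw hv
  grind

/-- In a connected unicyclic graph, at most one vertex off a path `a b c d` with `a` and `d` at
distance three is within distance two of all four vertices of the path. -/
theorem eq_of_near_path {G : SimpleGraph V} [DecidableRel G.Adj] (hconn : G.Connected)
    (huni : G.edgeFinset.card = Fintype.card V) {a b c d : V}
    (hab : G.Adj a b) (hbc : G.Adj b c) (hcd : G.Adj c d) (had : 2 < G.dist a d) {v w : V}
    (hv : v ∉ ({a, b, c, d} : Finset V)) (hw : w ∉ ({a, b, c, d} : Finset V))
    (hvd : ∀ q ∈ ({a, b, c, d} : Finset V), G.dist v q ≤ 2)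
    (hwd : ∀ q ∈ ({a, b, c, d} : Finset V), G.dist w q ≤ 2) : v = w := by
  simp only [Finset.mem_insert, Finset.mem_singleton, not_or, forall_eq_or_imp, forall_eq]
    at hv hw hvd hwd
  have hnad : ∀ z, G.Adj a z → ¬ G.Adj z d := by
    intro z h1 h2
    have := SimpleGraph.dist_le (h1.toWalk.append h2.toWalk)
    simp at this
    omega
  have hnd : ¬ G.Adj a d := fun h => by
    have := SimpleGraph.dist_eq_one_iff_adj.2 h
    omega
  have hdb : d ≠ b := by rintro rfl; exact hnd hab
  have hadj : ∀ u, G.Adj b u → G.dist b u = 1 := fun u h => SimpleGraph.dist_eq_one_iff_adj.2 h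
  have hla := hadj a hab.symm
  have hlc := hadj c hbc
  have hlb : G.dist b b = 0 := SimpleGraph.dist_self
  have hld : G.dist b d = 2 := by
    have h1 := hcd.diff_dist_adj (u := b)
    have h2 := hconn.dist_triangle (u := a) (v := b) (w := d)
    rw [G.dist_comm (u := a) (v := b)] at h2
    omega
  have hac : a ≠ c := by rintro rfl; exact hnd hcd
  obtain ⟨p, hp, hpd⟩ : ∃ p, IsParentMap G b p ∧ p d = c := by
    obtain ⟨p, hp⟩ := exists_isParentMap hconn b
    refine ⟨Function.update p d c, fun v hv => ?_, Function.update_self ..⟩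
    by_cases hvd : v = d
    · subst hvd
      rw [Function.update_self]
      exact ⟨hcd, by omega⟩
    · rw [Function.update_of_ne hvd]
      exact hp v hv
  obtain ⟨x, y, hxyadj, -, -, hxy⟩ := exists_extra_edge huni hp
  have hxylev := hxyadj.diff_dist_adj (u := b)
  have hl0 : ∀ u, G.dist b u = 0 → u = b := fun u hu => (hconn.dist_eq_zero_iff.1 hu).symm
  have hl1 : ∀ u, G.dist b u = 1 → p u = b := by
    intro u hu
    have hub : u ≠ b := by rintro rfl; omega
    have h1 := (hp u hub).2
    exact hl0 _ (by omega)
  have key : ∀ u, (u ≠ a ∧ u ≠ b ∧ u ≠ c ∧ u ≠ d) →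
      (G.dist u a ≤ 2 ∧ G.dist u b ≤ 2 ∧ G.dist u c ≤ 2 ∧ G.dist u d ≤ 2) →
      ExtraEdgeShape p a b c d x y u := fun u hu hud =>
    extraEdgeShape_of_near (A := G.Adj) (l := G.dist b) (p := p) (x := x) (y := y) (w := u)
      hbc hcd hpd hxy hu.1 hu.2.1 hu.2.2.1 hu.2.2.2 (by omega) (by omega) hla hlb hlc
      hnad hnd hdb hld (hl1 a hla) (hl1 c hlc)
      ((eq_or_adj_or_exists_of_dist_le_two hconn hud.1).resolve_left hu.1)
      (by rw [G.dist_comm]; exact hud.2.1)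
      ((eq_or_adj_or_exists_of_dist_le_two hconn hud.2.2.1).resolve_left hu.2.2.1)
      ((eq_or_adj_or_exists_of_dist_le_two hconn hud.2.2.2).resolve_left hu.2.2.2)
      hl0 hl1 (fun _ _ h => h.symm)
  exact eq_of_extraEdgeShape (l := G.dist b) hpd hv.1 hv.2.1 hv.2.2.1 hv.2.2.2
    hw.1 hw.2.1 hw.2.2.1 hw.2.2.2 hla hlb hlc hdb hld (hl1 a hla) (hl1 c hlc) hac (key v hv hvd)
    (key w hw hwd)

/-- The ordered pairs of vertices at distance at least three. -/
noncomputable def farPairs (G : SimpleGraph V) : Finset (V × V) :=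
  Finset.univ.filter fun q => 2 < G.dist q.1 q.2

theorem exists_path_of_two_lt_dist {W : Type*} [Fintype W] {G : SimpleGraph W}
    (hconn : G.Connected) {s t : W} (h : 2 < G.dist s t) :
    ∃ b c d, G.Adj s b ∧ G.Adj b c ∧ G.Adj c d ∧ 2 < G.dist s d := by
  obtain ⟨d, hd, hmin⟩ := Finset.exists_min_image (Finset.univ.filter fun u => 2 < G.dist s u)
    (G.dist s) ⟨t, by simpa using h⟩
  simp only [Finset.mem_filter, Finset.mem_univ, true_and] at hd hmin
  have hne : ∀ u, 0 < G.dist s u → u ≠ s := by rintro u hu rfl; simp at hu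
  obtain ⟨c, hcd, hc⟩ := exists_adj_dist_succ hconn (hne d (by omega))
  have hc2 : ¬ 2 < G.dist s c := fun h => by have := hmin c h; omega
  obtain ⟨b, hbc, hb⟩ := exists_adj_dist_succ hconn (hne c (by omega))
  exact ⟨b, c, d, SimpleGraph.dist_eq_one_iff_adj.1 (by omega), hbc, hcd, hd⟩

theorem card_farPairs {G : SimpleGraph V} [DecidableRel G.Adj] (hconn : G.Connected)
    (huni : G.edgeFinset.card = Fintype.card V) {a t : V} (hat : 2 < G.dist a t) :
    2 * Fintype.card V ≤ (farPairs G).card + 8 := by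
  obtain ⟨b, c, d, hab, hbc, hcd, had⟩ := exists_path_of_two_lt_dist hconn hat
  set Q : Finset V := {a, b, c, d} with hQ
  have hQcard : Q.card ≤ 4 := Finset.card_le_four
  set F := Qᶜ.filter fun w => ∃ q ∈ Q, 2 < G.dist w q with hF
  set B := Qᶜ.filter fun w => ¬ ∃ q ∈ Q, 2 < G.dist w q with hB
  have hFB : F.card + B.card = Qᶜ.card := Finset.card_filter_add_card_filter_not _
  have hBcard : B.card ≤ 1 := by
    refine Finset.card_le_one.2 fun v hv w hw => ?_
    simp only [hB, Finset.mem_filter, Finset.mem_compl, not_exists, not_and, not_lt] at hv hw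
    exact eq_of_near_path hconn huni hab hbc hcd had hv.1 hw.1 hv.2 hw.2
  have hQc := Finset.card_compl Q
  have hex : ∀ w, ∃ q, w ∈ F → q ∈ Q ∧ 2 < G.dist w q := by
    intro w
    by_cases hw : w ∈ F
    · obtain ⟨q, hq⟩ := (Finset.mem_filter.1 hw).2
      exact ⟨q, fun _ => hq⟩
    · exact ⟨w, fun h => absurd h hw⟩
  choose f hf using hex
  have hFQ : ∀ w ∈ F, w ∉ Q := fun w hw => Finset.mem_compl.1 (Finset.mem_filter.1 hw).1
  set F1 := F.image fun w => (w, f w) with hF1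
  set F2 := F.image fun w => (f w, w) with hF2
  set F3 : Finset (V × V) := {(a, d), (d, a)} with hF3
  have h1 : F1.card = F.card :=
    Finset.card_image_of_injective _ fun u v h => congrArg Prod.fst h
  have h2 : F2.card = F.card :=
    Finset.card_image_of_injective _ fun u v h => congrArg Prod.snd h
  have hne : a ≠ d := by rintro rfl; simp at had
  have h3 : F3.card = 2 := Finset.card_pair (by simp [hne])
  have haQ : a ∈ Q := by simp [hQ]
  have hdQ : d ∈ Q := by simp [hQ]
  have h12 : Disjoint F1 F2 := by
    rw [Finset.disjoint_left]
    rintro q hq1 hq2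
    obtain ⟨w, hw, rfl⟩ := Finset.mem_image.1 hq1
    obtain ⟨v, hv, h⟩ := Finset.mem_image.1 hq2
    have h : f v = w := congrArg Prod.fst h
    exact hFQ w hw (h ▸ (hf v hv).1)
  have h123 : Disjoint (F1 ∪ F2) F3 := by
    rw [Finset.disjoint_right]
    intro q hq hq'
    have hq3 : q.1 ∈ Q ∧ q.2 ∈ Q := by
      simp only [hF3, Finset.mem_insert, Finset.mem_singleton] at hq
      rcases hq with rfl | rfl
      exacts [⟨haQ, hdQ⟩, ⟨hdQ, haQ⟩]
    rcases Finset.mem_union.1 hq' with hq' | hq'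
    · obtain ⟨w, hw, rfl⟩ := Finset.mem_image.1 hq'
      exact hFQ w hw hq3.1
    · obtain ⟨w, hw, rfl⟩ := Finset.mem_image.1 hq'
      exact hFQ w hw hq3.2
  have hsub : F1 ∪ F2 ∪ F3 ⊆ farPairs G := by
    refine Finset.union_subset (Finset.union_subset ?_ ?_) ?_
    · refine Finset.image_subset_iff.2 fun w hw => ?_
      simpa [farPairs] using (hf w hw).2
    · refine Finset.image_subset_iff.2 fun w hw => ?_
      simpa [farPairs, G.dist_comm (u := f w)] using (hf w hw).2
    · intro q hq
      simp only [hF3, Finset.mem_insert, Finset.mem_singleton] at hq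
      rcases hq with rfl | rfl
      · simpa [farPairs] using had
      · simpa [farPairs, G.dist_comm (u := d)] using had
  have hle := Finset.card_le_card hsub
  rw [Finset.card_union_of_disjoint h123, Finset.card_union_of_disjoint h12] at hle
  omega

theorem le_sigma {G : SimpleGraph V} [DecidableRel G.Adj] (hconn : G.Connected) :
    (Fintype.card V : ℝ) ^ 2 - Fintype.card V - G.edgeFinset.card + (farPairs G).card / 2
      ≤ sigma G := by
  have hpt : ∀ u v, (2 : ℝ) - (if u = v then 2 else 0) - (if G.Adj u v then 1 else 0) +
      (if 2 < G.dist u v then 1 else 0) ≤ G.dist u v := by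
    intro u v
    by_cases huv : u = v
    · subst huv; simp
    · by_cases hadj : G.Adj u v
      · have := SimpleGraph.dist_eq_one_iff_adj.2 hadj
        simp [huv, hadj, this]
        norm_num
      · have h2 := hconn.one_lt_dist_of_ne_of_not_adj huv hadj
        simp only [huv, hadj, if_false]
        split_ifs with h3
        · have : (3 : ℝ) ≤ G.dist u v := by exact_mod_cast h3
          linarith
        · have : (2 : ℝ) ≤ G.dist u v := by exact_mod_cast h2
          linarith
  have hsum := Finset.sum_le_sum fun u (_ : u ∈ Finset.univ) =>
    Finset.sum_le_sum fun v (_ : v ∈ Finset.univ) => hpt u v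
  have hdeg : ∑ u, ∑ v, (if G.Adj u v then (1 : ℝ) else 0) = 2 * G.edgeFinset.card := by
    rw [← Nat.cast_ofNat (R := ℝ) (n := 2), ← Nat.cast_mul, ← G.sum_degrees_eq_twice_card_edges]
    push_cast
    refine Finset.sum_congr rfl fun u _ => ?_
    rw [Finset.sum_boole, ← G.card_neighborFinset_eq_degree, G.neighborFinset_eq_filter]
  have hfar : ∑ u, ∑ v, (if 2 < G.dist u v then (1 : ℝ) else 0) = (farPairs G).card := by
    rw [← Finset.sum_product', Finset.sum_boole, farPairs, Finset.univ_product_univ]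
  simp only [Finset.sum_add_distrib, Finset.sum_sub_distrib, hdeg, hfar] at hsum
  simp only [Finset.sum_const, Finset.card_univ, Finset.sum_ite_eq, Finset.mem_univ, if_true,
    nsmul_eq_mul] at hsum
  unfold sigma
  linarith

/-- If `w` has level two and is within distance two of all neighbours of the root `c`, then at most
one neighbour of `c` is not the parent of `w`. -/
theorem eq_of_ne_parent {W : Type*} {A : W → W → Prop} {l : W → ℕ} {c x y w v1 v2 : W} {p : W → W}
    (hw : w ≠ c) (hcw : ¬ A c w)
    (hxy : ∀ u v, A u v → (p v = u ∧ l v = l u + 1) ∨ (p u = v ∧ l u = l v + 1) ∨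
      (u = x ∧ v = y) ∨ (u = y ∧ v = x))
    (hb0 : ∀ v, l v = 0 ↔ v = c) (hl2 : ∀ v, l v ≤ 2) (hl0 : ∀ v, l v = 1 → p v = c)
    (hsym : ∀ u v, A u v → A v u) (hl1 : ∀ v, l v = 1 ↔ A c v) (hw2 : l w = 2)
    (h : ∀ v, A c v → A v w ∨ ∃ z, A v z ∧ A z w)
    (hv1 : A c v1) (hv2 : A c v2) (h1 : v1 ≠ p w) (h2 : v2 ≠ p w) : v1 = v2 := by
  have l1 := (hl1 _).2 hv1
  have l2 := (hl1 _).2 hv2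
  have l3 := hl0 _ l1
  have l4 := hl0 _ l2
  obtain ha | ⟨z1, ha1, ha2⟩ := h v1 hv1 <;> obtain hb | ⟨z2, hb1, hb2⟩ := h v2 hv2 <;> grind

theorem neighbors_subset_pair {G : SimpleGraph V} [DecidableRel G.Adj] (hconn : G.Connected)
    (huni : G.edgeFinset.card = Fintype.card V) (hdiam : ∀ u v, G.dist u v ≤ 2) {c w k : V}
    (hw : w ≠ c) (hcw : ¬ G.Adj c w) (hk : G.Adj c k) :
    ∃ t, ∀ z, G.Adj c z → z = k ∨ z = t := by
  obtain ⟨p, hp⟩ := exists_isParentMap hconn c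
  obtain ⟨x, y, -, -, -, hxy⟩ := exists_extra_edge huni hp
  have hl0 : ∀ u, G.dist c u = 0 ↔ u = c := fun u => by rw [hconn.dist_eq_zero_iff, eq_comm]
  have hl1 : ∀ u, G.dist c u = 1 → p u = c := by
    intro u hu
    have huc : u ≠ c := by rintro rfl; simp at hu
    have h1 := (hp u huc).2
    exact (hl0 _).1 (by omega)
  have hw2 : G.dist c w = 2 := by
    have h1 := hconn.one_lt_dist_of_ne_of_not_adj hw.symm hcw
    have h2 := hdiam c w
    omega
  have key : ∀ v1 v2, G.Adj c v1 → G.Adj c v2 → v1 ≠ p w → v2 ≠ p w → v1 = v2 :=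
    fun v1 v2 => eq_of_ne_parent (A := G.Adj) (l := G.dist c) hw hcw hxy hl0 (hdiam c) hl1
      (fun _ _ h => h.symm) (fun v => SimpleGraph.dist_eq_one_iff_adj) hw2
      (fun v hv => (eq_or_adj_or_exists_of_dist_le_two hconn (hdiam v w)).resolve_left
        (by rintro rfl; exact hcw hv))
  by_cases hkp : k = p w
  · by_cases h : ∃ t, G.Adj c t ∧ t ≠ p w
    · obtain ⟨t, ht, htp⟩ := h
      refine ⟨t, fun z hz => ?_⟩
      by_cases hzp : z = p w
      · exact Or.inl (hzp.trans hkp.symm)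
      · exact Or.inr (key z t hz ht hzp htp)
    · refine ⟨k, fun z hz => Or.inl ?_⟩
      by_contra hzk
      exact h ⟨z, hz, hkp ▸ hzk⟩
  · refine ⟨p w, fun z hz => ?_⟩
    by_cases hzp : z = p w
    · exact Or.inr hzp
    · exact Or.inl (key z k hz hk hzp hkp)

theorem exists_dominating {G : SimpleGraph V} [DecidableRel G.Adj] (hconn : G.Connected)
    (huni : G.edgeFinset.card = Fintype.card V) (hdiam : ∀ u v, G.dist u v ≤ 2)
    (hcard : 6 ≤ Fintype.card V) : ∃ c, ∀ v, v ≠ c → G.Adj c v := by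
  by_contra! hdom
  have hpair : ∀ c k, G.Adj c k → ∃ t, ∀ z, G.Adj c z → z = k ∨ z = t := fun c k hk => by
    obtain ⟨w, hw, hcw⟩ := hdom c
    exact neighbors_subset_pair hconn huni hdiam hw hcw hk
  obtain ⟨c⟩ := hconn.nonempty
  obtain ⟨k, hk⟩ : ∃ k, G.Adj c k := by
    obtain ⟨w, hw, hcw⟩ := hdom c
    rcases eq_or_adj_or_exists_of_dist_le_two hconn (hdiam c w) with h | h | ⟨z, h, -⟩
    exacts [absurd h.symm hw, ⟨w, h⟩, ⟨z, h⟩]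
  obtain ⟨t, ht⟩ := hpair c k hk
  obtain ⟨k', hk'⟩ := hpair k c hk.symm
  obtain ⟨t', ht'⟩ : ∃ t', G.Adj c t → ∀ z, G.Adj t z → z = c ∨ z = t' := by
    by_cases h : G.Adj c t
    · obtain ⟨t', ht'⟩ := hpair t c h.symm
      exact ⟨t', fun _ => ht'⟩
    · exact ⟨c, fun h' => absurd h' h⟩
  have hsub : (Finset.univ : Finset V) ⊆ {c, k, t, k', t'} := by
    intro v _
    simp only [Finset.mem_insert, Finset.mem_singleton]
    rcases eq_or_adj_or_exists_of_dist_le_two hconn (hdiam c v) with h | h | ⟨z, h1, h2⟩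
    · exact Or.inl h.symm
    · have := ht v h
      tauto
    · rcases ht z h1 with rfl | rfl
      · have := hk' v h2
        tauto
      · have := ht' h1 v h2
        tauto
  have h5 : ({c, k, t, k', t'} : Finset V).card ≤ 5 := Finset.card_le_five
  have := Finset.card_le_card hsub
  rw [Finset.card_univ] at this
  omega

theorem nonempty_iso_SnPlus {G : SimpleGraph V} [DecidableRel G.Adj]
    (huni : G.edgeFinset.card = Fintype.card V) {n : ℕ} (hn : 3 ≤ n) (hcard : Fintype.card V = n)
    {c : V} (hc : ∀ v, v ≠ c → G.Adj c v) : Nonempty (G ≃g SnPlus n) := by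
  have hp : IsParentMap G c fun _ => c := fun v hv =>
    ⟨hc v hv, by simp [SimpleGraph.dist_eq_one_iff_adj.2 (hc v hv)]⟩
  obtain ⟨x, y, hadj, hx, hy, hxy⟩ := exists_extra_edge huni hp
  have hxc : x ≠ c := by
    rintro rfl
    exact hy hadj.ne' rfl
  have hyc : y ≠ c := by
    rintro rfl
    exact hx hxc rfl
  have hxy' := hadj.ne
  obtain ⟨e, hec, hex, hey⟩ : ∃ e : V ≃ Fin n,
      e c = ⟨0, by omega⟩ ∧ e x = ⟨1, by omega⟩ ∧ e y = ⟨2, by omega⟩ := by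
    set e0 := Fintype.equivFinOfCardEq hcard
    set e1 := e0.trans (Equiv.swap (e0 c) ⟨0, by omega⟩) with he1
    have h1c : e1 c = ⟨0, by omega⟩ := by simp [he1]
    set e2 := e1.trans (Equiv.swap (e1 x) ⟨1, by omega⟩) with he2
    have h2c : e2 c = ⟨0, by omega⟩ := by
      rw [he2, Equiv.trans_apply, Equiv.swap_apply_of_ne_of_ne (e1.injective.ne hxc.symm), h1c]
      simp [h1c]
    have h2x : e2 x = ⟨1, by omega⟩ := by simp [he2]
    refine ⟨e2.trans (Equiv.swap (e2 y) ⟨2, by omega⟩), ?_, ?_, by simp⟩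
    · rw [Equiv.trans_apply, Equiv.swap_apply_of_ne_of_ne (e2.injective.ne hyc.symm), h2c]
      simp [h2c]
    · rw [Equiv.trans_apply, Equiv.swap_apply_of_ne_of_ne (e2.injective.ne hxy'), h2x]
      simp [h2x]
  have h0 : ∀ u, (e u).val = 0 ↔ u = c := fun u => by
    rw [← e.injective.eq_iff, hec, Fin.ext_iff]
  have h1 : ∀ u, (e u).val = 1 ↔ u = x := fun u => by
    rw [← e.injective.eq_iff, hex, Fin.ext_iff]
  have h2 : ∀ u, (e u).val = 2 ↔ u = y := fun u => by
    rw [← e.injective.eq_iff, hey, Fin.ext_iff]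
  refine ⟨e, fun {u v} => ?_⟩
  simp only [SnPlus, SimpleGraph.fromRel_adj, h0, h1, h2, ne_eq, e.injective.eq_iff]
  constructor
  · rintro ⟨huv, (rfl | ⟨rfl, rfl⟩) | (rfl | ⟨rfl, rfl⟩)⟩
    · exact hc v (Ne.symm huv)
    · exact hadj
    · exact (hc u huv).symm
    · exact hadj.symm
  · intro h
    have := hxy u v h
    have := h.ne
    tauto

theorem sigma_SnPlus {n : ℕ} (hn : 3 ≤ n) : sigma (SnPlus n) = (n : ℝ) ^ 2 - 2 * n := by
  obtain ⟨m, rfl⟩ : ∃ m, n = m + 3 := ⟨n - 3, by omega⟩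
  have hdist : ∀ u v : Fin (m + 3), ((SnPlus (m + 3)).dist u v : ℝ) =
      2 - (if u = v then 2 else 0) - (if u = 0 then 1 else 0) - (if v = 0 then 1 else 0)
        + (if u = 0 then if v = 0 then 2 else 0 else 0)
        - (if u = 1 then if v = 2 then 1 else 0 else 0)
        - (if u = 2 then if v = 1 then 1 else 0 else 0) := by
    have hadj : ∀ u v, (SnPlus (m + 3)).Adj u v ↔
        u ≠ v ∧ ((u = 0 ∨ u = 1 ∧ v = 2) ∨ (v = 0 ∨ v = 1 ∧ u = 2)) := by
      intro u v
      have h1 : ∀ u : Fin (m + 3), u.val = 1 ↔ u = 1 := fun u => by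
        rw [Fin.ext_iff]; rfl
      have h2 : ∀ u : Fin (m + 3), u.val = 2 ↔ u = 2 := fun u => by
        rw [Fin.ext_iff]; rfl
      simp only [SnPlus, SimpleGraph.fromRel_adj, Fin.val_eq_zero_iff, h1, h2]
    have h01 : (0 : Fin (m + 3)) ≠ 1 := by simp
    have h02 : (0 : Fin (m + 3)) ≠ 2 := by rw [ne_eq, Fin.ext_iff]; exact (by decide : (0 : ℕ) ≠ 2)
    have h12 : (1 : Fin (m + 3)) ≠ 2 := by rw [ne_eq, Fin.ext_iff]; exact (by decide : (1 : ℕ) ≠ 2)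
    intro u v
    by_cases huv : u = v
    · subst huv
      rw [SimpleGraph.dist_self]
      split_ifs <;> simp_all <;> norm_num
    · by_cases h : (SnPlus (m + 3)).Adj u v
      · rw [SimpleGraph.dist_eq_one_iff_adj.2 h]
        rw [hadj] at h
        rcases h.2 with (rfl | ⟨rfl, rfl⟩) | (rfl | ⟨rfl, rfl⟩) <;>
          (simp_all [eq_comm]; norm_num)
      · have hd : (SnPlus (m + 3)).dist u v = 2 := by
          rw [hadj] at h
          have hu : (SnPlus (m + 3)).Adj u 0 := by rw [hadj]; tauto
          have hv : (SnPlus (m + 3)).Adj 0 v := by rw [hadj]; grind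
          have hle := SimpleGraph.dist_le (hu.toWalk.append hv.toWalk)
          have hreach := (hu.toWalk.append hv.toWalk).reachable
          have hlt := hreach.one_lt_dist_of_ne_of_not_adj huv (by rwa [hadj])
          simp at hle
          omega
        rw [hd]
        rw [hadj] at h
        push Not at h
        have h := h huv
        grind
  simp only [sigma, hdist]
  simp [Finset.sum_add_distrib, Finset.sum_sub_distrib, Finset.sum_ite_irrel]
  ring

/-- every unicyclic graph on `n ≥ 6` vertices other than `Sₙ⁺` has
`σ(G) ≥ n² - n - 4 > σ(Sₙ⁺) = n² - 2n`. -/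
theorem sigma_unicyclic (n : ℕ) (hn : 6 ≤ n) (G : SimpleGraph V) [DecidableRel G.Adj]
    (hcard : Fintype.card V = n) (hconn : G.Connected)
    (huni : G.edgeFinset.card = n) (hne : ¬ Nonempty (G ≃g SnPlus n)) :
    sigma G ≥ (n : ℝ) ^ 2 - n - 4 ∧
      ((n : ℝ) ^ 2 - n - 4 > sigma (SnPlus n)) ∧
      sigma (SnPlus n) = (n : ℝ) ^ 2 - 2 * n := by
  have hS := sigma_SnPlus (n := n) (by omega)
  have hn' : (6 : ℝ) ≤ n := by exact_mod_cast hn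
  refine ⟨?_, by rw [hS]; linarith, hS⟩
  have huni' : G.edgeFinset.card = Fintype.card V := huni.trans hcard.symm
  obtain ⟨a, t, hat⟩ : ∃ a t, 2 < G.dist a t := by
    by_contra! hdiam
    obtain ⟨c, hc⟩ := exists_dominating hconn huni' hdiam (by omega)
    exact hne (nonempty_iso_SnPlus huni' (by omega) hcard hc)
  have hfar : (2 * Fintype.card V : ℝ) ≤ (farPairs G).card + 8 := by
    exact_mod_cast card_farPairs hconn huni' hat
  have hle := le_sigma hconn
  rw [huni'] at hle
  rw [hcard] at hle hfar
  linarith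

end DistAlpha
end

section
/- Let G be a connected graph on n ≥ 4 vertices that is not a path. Then μ_α(G) ≤ μ_α(B_{n,3}) < μ_α(P_n), with equality in the first inequality if and only if G ≅ B_{n,3}, where B_{n,3} is the tree obtained by attaching 2 pendant vertices to one end of the path P_{n−2}. -/
open Finset Matrix

namespace DistAlpha

variable {V : Type*} [Fintype V] [DecidableEq V]

/-- The broom `B_{n,3}`: the path `0 - 1 - ⋯ - (n-3)` with two pendant vertices `n-2` and
`n-1` attached to the end vertex `n-3`. -/
def broom (n : ℕ) : SimpleGraph (Fin n) :=
  SimpleGraph.fromRel (fun u v =>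
    (u.val + 1 = v.val ∧ v.val ≤ n - 3) ∨
    (u.val = n - 3 ∧ (v.val = n - 2 ∨ v.val = n - 1)))

/-- The coefficient of `d(u, v)` in the quadratic form of `D_α` at `x`. -/
noncomputable def pairWeight {ι : Type*} (α : ℝ) (x : ι → ℝ) (u v : ι) : ℝ :=
  α * (x u ^ 2 + x v ^ 2) / 2 + (1 - α) * (x u * x v)

theorem pairWeight_pos {ι : Type*} {α : ℝ} (hα0 : 0 ≤ α) (hα1 : α < 1) {x : ι → ℝ}
    (hx : ∀ i, 0 < x i) (u v : ι) : 0 < pairWeight α x u v := by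
  have h1 := mul_pos (sub_pos.2 hα1) (mul_pos (hx u) (hx v))
  have h2 : 0 ≤ α * (x u ^ 2 + x v ^ 2) / 2 := by positivity
  exact add_pos_of_nonneg_of_pos h2 h1

theorem pairWeight_le {ι : Type*} {α : ℝ} (hα1 : α < 1) (x : ι → ℝ) (u v : ι) :
    pairWeight α x u v ≤ (x u ^ 2 + x v ^ 2) / 2 := by
  unfold pairWeight
  nlinarith [mul_nonneg (sub_pos.2 hα1).le (sq_nonneg (x u - x v))]

section Energy

variable {W : Type*} [Fintype W]

/-- The quadratic form of `D_α`, as a weighted sum of distances. -/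
noncomputable def energy (G : SimpleGraph W) (α : ℝ) (x : W → ℝ) : ℝ :=
  ∑ u, ∑ v, (G.dist u v : ℝ) * pairWeight α x u v

theorem energy_lt_energy {G H : SimpleGraph W} {α : ℝ} (hα0 : 0 ≤ α) (hα1 : α < 1) {x : W → ℝ}
    (hx : ∀ i, 0 < x i) (hle : ∀ u v, G.dist u v ≤ H.dist u v)
    (hlt : ∃ u v, G.dist u v < H.dist u v) : energy G α x < energy H α x := by
  obtain ⟨u, v, huv⟩ := hlt
  have hterm : ∀ a b, (G.dist a b : ℝ) * pairWeight α x a b ≤ H.dist a b * pairWeight α x a b :=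
    fun a b => mul_le_mul_of_nonneg_right (by exact_mod_cast hle a b)
      (pairWeight_pos hα0 hα1 hx a b).le
  refine Finset.sum_lt_sum (fun a _ => Finset.sum_le_sum fun b _ => hterm a b)
    ⟨u, Finset.mem_univ u, Finset.sum_lt_sum (fun b _ => hterm u b) ⟨v, Finset.mem_univ v, ?_⟩⟩
  exact mul_lt_mul_of_pos_right (by exact_mod_cast huv) (pairWeight_pos hα0 hα1 hx u v)

/-- If the distances of `G` are dominated by the averages of those of two relabelled graphs, then
the energy of one of these exceeds that of `G`. -/
theorem energy_lt_or_energy_lt {W' : Type*} [Fintype W'] {G : SimpleGraph W}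
    {G₁ G₂ : SimpleGraph W'} (e₁ e₂ : W ≃ W') {α : ℝ} (hα0 : 0 ≤ α) (hα1 : α < 1) {x : W → ℝ}
    (hx : ∀ i, 0 < x i)
    (hle : ∀ u v, 2 * G.dist u v ≤ G₁.dist (e₁ u) (e₁ v) + G₂.dist (e₂ u) (e₂ v))
    (hlt : ∃ u v, 2 * G.dist u v < G₁.dist (e₁ u) (e₁ v) + G₂.dist (e₂ u) (e₂ v)) :
    energy G α x < energy G₁ α (x ∘ e₁.symm) ∨ energy G α x < energy G₂ α (x ∘ e₂.symm) := by
  have hre : ∀ (H : SimpleGraph W') (e : W ≃ W'), energy H α (x ∘ e.symm)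
      = ∑ u, ∑ v, (H.dist (e u) (e v) : ℝ) * pairWeight α x u v := by
    intro H e
    rw [energy, ← e.sum_comp]
    refine Finset.sum_congr rfl fun u _ => ?_
    rw [← e.sum_comp]
    simp [pairWeight]
  obtain ⟨u, v, huv⟩ := hlt
  have hterm : ∀ a b, (2 * G.dist a b : ℝ) * pairWeight α x a b
      ≤ (G₁.dist (e₁ a) (e₁ b) + G₂.dist (e₂ a) (e₂ b)) * pairWeight α x a b :=
    fun a b => mul_le_mul_of_nonneg_right (by exact_mod_cast hle a b)
      (pairWeight_pos hα0 hα1 hx a b).le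
  have hsum : ∑ a, ∑ b, (2 * G.dist a b : ℝ) * pairWeight α x a b
      < ∑ a, ∑ b, (G₁.dist (e₁ a) (e₁ b) + G₂.dist (e₂ a) (e₂ b) : ℝ) * pairWeight α x a b := by
    refine Finset.sum_lt_sum (fun a _ => Finset.sum_le_sum fun b _ => hterm a b)
      ⟨u, Finset.mem_univ u, Finset.sum_lt_sum (fun b _ => hterm u b) ⟨v, Finset.mem_univ v, ?_⟩⟩
    exact mul_lt_mul_of_pos_right (by exact_mod_cast huv) (pairWeight_pos hα0 hα1 hx u v)
  have h1 : 2 * energy G α x = ∑ a, ∑ b, (2 * G.dist a b : ℝ) * pairWeight α x a b := by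
    simp only [energy, Finset.mul_sum, mul_assoc]
  have h2 : energy G₁ α (x ∘ e₁.symm) + energy G₂ α (x ∘ e₂.symm)
      = ∑ a, ∑ b, (G₁.dist (e₁ a) (e₁ b) + G₂.dist (e₂ a) (e₂ b) : ℝ) * pairWeight α x a b := by
    rw [hre, hre]
    simp only [← Finset.sum_add_distrib, add_mul]
  by_contra! h
  linarith [h.1, h.2]

end Energy

section Spectral

variable {W : Type*} [Fintype W] [DecidableEq W]

theorem posSemidef_sSup_spectrum_sub {A : Matrix W W ℝ} (hA : A.IsHermitian) :
    (algebraMap ℝ (Matrix W W ℝ) (sSup (spectrum ℝ A)) - A).PosSemidef := by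
  rw [Matrix.posSemidef_iff_isHermitian_and_spectrum_nonneg]
  refine ⟨?_, ?_⟩
  · refine Matrix.IsHermitian.sub ?_ hA
    rw [Matrix.algebraMap_eq_diagonal]
    exact Matrix.isHermitian_diagonal _
  · rw [← spectrum.singleton_sub_eq]
    rintro _ ⟨_, rfl, b, hb, rfl⟩
    exact sub_nonneg.2 (le_csSup A.finite_real_spectrum.bddAbove hb)

theorem algebraMap_sub_mulVec (A : Matrix W W ℝ) (r : ℝ) (x : W → ℝ) :
    (algebraMap ℝ (Matrix W W ℝ) r - A) *ᵥ x = r • x - A *ᵥ x := by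
  rw [Matrix.sub_mulVec, Algebra.algebraMap_eq_smul_one, Matrix.smul_mulVec, Matrix.one_mulVec]

theorem dotProduct_mulVec_le_sSup_spectrum {A : Matrix W W ℝ} (hA : A.IsHermitian) (x : W → ℝ) :
    x ⬝ᵥ A *ᵥ x ≤ sSup (spectrum ℝ A) * (x ⬝ᵥ x) := by
  have h := (posSemidef_sSup_spectrum_sub hA).dotProduct_mulVec_nonneg x
  rw [algebraMap_sub_mulVec, dotProduct_sub, dotProduct_smul, star_trivial, smul_eq_mul] at h
  linarith

/-- Perron vector of a symmetric matrix with positive off-diagonal entries. -/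
theorem exists_pos_eigenvector [Nontrivial W] {A : Matrix W W ℝ} (hA : A.IsHermitian)
    (h0 : ∀ i j, 0 ≤ A i j) (hpos : ∀ i j, i ≠ j → 0 < A i j) :
    ∃ x : W → ℝ, (∀ i, 0 < x i) ∧ A *ᵥ x = sSup (spectrum ℝ A) • x := by
  set μ := sSup (spectrum ℝ A) with hμ
  have hne : (spectrum ℝ A).Nonempty := by
    rw [hA.spectrum_real_eq_range_eigenvalues]
    exact Set.range_nonempty _
  have hmem : μ ∈ spectrum ℝ A := hne.csSup_mem A.finite_real_spectrum
  rw [hA.spectrum_real_eq_range_eigenvalues] at hmem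
  obtain ⟨k, hk⟩ := hmem
  set v : W → ℝ := (hA.eigenvectorBasis k).ofLp with hv
  have hAv : A *ᵥ v = μ • v := by rw [← hk]; exact hA.mulVec_eigenvectorBasis k
  have hv0 : v ≠ 0 := by
    intro h
    apply hA.eigenvectorBasis.orthonormal.ne_zero k
    ext i
    exact congrFun h i
  set x : W → ℝ := fun i => |v i| with hx
  have hxx : x ⬝ᵥ x = v ⬝ᵥ v := by simp [dotProduct, hx]
  have hquad : μ * (x ⬝ᵥ x) ≤ x ⬝ᵥ A *ᵥ x := by
    have h1 : v ⬝ᵥ A *ᵥ v = μ * (v ⬝ᵥ v) := by rw [hAv, dotProduct_smul, smul_eq_mul]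
    rw [hxx, ← h1]
    simp only [dotProduct, mulVec, Finset.mul_sum]
    refine Finset.sum_le_sum fun i _ => Finset.sum_le_sum fun j _ => ?_
    calc v i * (A i j * v j) ≤ |v i * (A i j * v j)| := le_abs_self _
      _ = x i * (A i j * x j) := by rw [abs_mul, abs_mul, abs_of_nonneg (h0 i j)]
  have hAx : A *ᵥ x = μ • x := by
    have hle := dotProduct_mulVec_le_sSup_spectrum hA x
    have := ((posSemidef_sSup_spectrum_sub hA).dotProduct_mulVec_zero_iff x).1 (by
      rw [algebraMap_sub_mulVec, dotProduct_sub, dotProduct_smul, star_trivial, smul_eq_mul]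
      linarith)
    rw [algebraMap_sub_mulVec, sub_eq_zero] at this
    exact this.symm
  refine ⟨x, fun i => ?_, hAx⟩
  refine lt_of_le_of_ne (abs_nonneg _) fun hi => hv0 ?_
  have hsum : ∑ j, A i j * x j = 0 := by
    have := congrFun hAx i
    simpa [mulVec, dotProduct, ← hi] using this
  rw [Finset.sum_eq_zero_iff_of_nonneg fun j _ => mul_nonneg (h0 i j) (abs_nonneg _)] at hsum
  funext j
  rcases eq_or_ne i j with rfl | hij
  · exact abs_eq_zero.1 hi.symm
  · have := (mul_eq_zero.1 (hsum j (Finset.mem_univ j))).resolve_left (hpos i j hij).ne'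
    exact abs_eq_zero.1 this

theorem dotProduct_Dalpha_mulVec (G : SimpleGraph W) (α : ℝ) (x : W → ℝ) :
    x ⬝ᵥ Dalpha G α *ᵥ x = energy G α x := by
  have hswap : ∑ u, ∑ v, (G.dist u v : ℝ) * x v ^ 2 = ∑ u, ∑ v, (G.dist u v : ℝ) * x u ^ 2 := by
    rw [Finset.sum_comm]
    simp_rw [SimpleGraph.dist_comm]
  have h1 : x ⬝ᵥ Dalpha G α *ᵥ x = α * ∑ u, ∑ v, (G.dist u v : ℝ) * x u ^ 2
      + (1 - α) * ∑ u, ∑ v, (G.dist u v : ℝ) * (x u * x v) := by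
    rw [Dalpha, add_mulVec, smul_mulVec, smul_mulVec, dotProduct_add, dotProduct_smul,
      dotProduct_smul, smul_eq_mul, smul_eq_mul]
    congr 2
    · simp only [dotProduct, mulVec_diagonal, transmission, Finset.sum_mul, Finset.mul_sum]
      exact Finset.sum_congr rfl fun u _ => Finset.sum_congr rfl fun v _ => by ring
    · simp only [dotProduct, mulVec, distMatrix, Finset.mul_sum]
      exact Finset.sum_congr rfl fun u _ => Finset.sum_congr rfl fun v _ => by ring
  have h2 : energy G α x = α / 2 * (∑ u, ∑ v, (G.dist u v : ℝ) * x u ^ 2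
      + ∑ u, ∑ v, (G.dist u v : ℝ) * x v ^ 2)
      + (1 - α) * ∑ u, ∑ v, (G.dist u v : ℝ) * (x u * x v) := by
    simp only [energy, pairWeight, Finset.mul_sum, ← Finset.sum_add_distrib]
    exact Finset.sum_congr rfl fun u _ => Finset.sum_congr rfl fun v _ => by ring
  rw [h1, h2, hswap]
  ring

theorem Dalpha_isHermitian (G : SimpleGraph W) (α : ℝ) : (Dalpha G α).IsHermitian := by
  refine Matrix.IsHermitian.ext fun i j => ?_
  rcases eq_or_ne i j with rfl | h
  · simp
  · simp [Dalpha, distMatrix, SimpleGraph.dist_comm, h, h.symm]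

theorem energy_le_muAlpha (G : SimpleGraph W) (α : ℝ) (x : W → ℝ) :
    energy G α x ≤ muAlpha G α * (x ⬝ᵥ x) := by
  rw [← dotProduct_Dalpha_mulVec]
  exact dotProduct_mulVec_le_sSup_spectrum (Dalpha_isHermitian G α) x

theorem exists_pos_energy_eq_muAlpha [Nontrivial W] {G : SimpleGraph W} (hG : G.Connected)
    {α : ℝ} (hα0 : 0 ≤ α) (hα1 : α < 1) :
    ∃ x : W → ℝ, (∀ i, 0 < x i) ∧ energy G α x = muAlpha G α * (x ⬝ᵥ x) := by
  have hpos : ∀ i j, i ≠ j → 0 < Dalpha G α i j := fun i j hij => by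
    have : (0 : ℝ) < G.dist i j := by exact_mod_cast hG.pos_dist_of_ne hij
    simpa [Dalpha, distMatrix, hij] using mul_pos (sub_pos.2 hα1) this
  obtain ⟨x, hx, hAx⟩ := exists_pos_eigenvector (Dalpha_isHermitian G α) (fun i j => by
    rcases eq_or_ne i j with rfl | hij
    · have : 0 ≤ transmission G i := Finset.sum_nonneg fun v _ => Nat.cast_nonneg (G.dist i v)
      simpa [Dalpha, distMatrix] using mul_nonneg hα0 this
    · exact (hpos i j hij).le) hpos
  refine ⟨x, hx, ?_⟩
  rw [← dotProduct_Dalpha_mulVec, hAx, dotProduct_smul, smul_eq_mul, muAlpha]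

end Spectral

theorem dist_iso_le {W W' : Type*} {G : SimpleGraph W} {H : SimpleGraph W'} (e : G ≃g H) {u v : W}
    (h : G.Reachable u v) : H.dist (e u) (e v) ≤ G.dist u v := by
  obtain ⟨p, hp⟩ := h.exists_walk_length_eq_dist
  rw [← hp, ← SimpleGraph.Walk.length_map e.toHom]
  exact SimpleGraph.dist_le _

theorem dist_iso {W W' : Type*} {G : SimpleGraph W} {H : SimpleGraph W'} (e : G ≃g H) (u v : W) :
    H.dist (e u) (e v) = G.dist u v := by
  by_cases h : G.Reachable u v
  · refine le_antisymm (dist_iso_le e h) ?_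
    simpa using dist_iso_le e.symm (e.reachable_iff.2 h)
  · rw [SimpleGraph.dist_eq_zero_of_not_reachable h,
      SimpleGraph.dist_eq_zero_of_not_reachable fun h' => h (e.reachable_iff.1 h')]

theorem muAlpha_congr {W W' : Type*} [Fintype W] [DecidableEq W] [Fintype W'] [DecidableEq W']
    {G : SimpleGraph W} {H : SimpleGraph W'} (e : G ≃g H) (α : ℝ) :
    muAlpha G α = muAlpha H α := by
  have hd : ∀ a b, G.dist (e.symm a) (e.symm b) = H.dist a b := dist_iso e.symm
  have ht : ∀ a, transmission G (e.symm a) = transmission H a := fun a => by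
    rw [transmission, transmission, ← e.symm.toEquiv.sum_comp]
    exact Finset.sum_congr rfl fun b _ => by exact_mod_cast hd a b
  have h : Matrix.reindexAlgEquiv ℝ ℝ e.toEquiv (Dalpha G α) = Dalpha H α := by
    ext a b
    have hD : (Matrix.reindexAlgEquiv ℝ ℝ e.toEquiv (Dalpha G α)) a b
        = Dalpha G α (e.symm a) (e.symm b) := rfl
    rw [hD]
    rcases eq_or_ne a b with rfl | hab
    · simp [Dalpha, distMatrix, ht]
    · simp [Dalpha, distMatrix, hd, hab]
  rw [muAlpha, muAlpha, ← h, AlgEquiv.spectrum_eq]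

section Surgery

variable {W : Type*} {G : SimpleGraph W}

theorem le_add_dist_of_lipschitz (hG : G.Connected) {f : W → ℤ}
    (hf : ∀ z z', G.Adj z z' → f z' ≤ f z + 1) (y z : W) : f z ≤ f y + G.dist y z := by
  have key : ∀ {y z : W} (p : G.Walk y z), f z ≤ f y + p.length := by
    intro y z p
    induction p with
    | nil => simp
    | cons h p ih =>
      rw [SimpleGraph.Walk.length_cons]
      push_cast
      linarith [hf _ _ h]
  obtain ⟨p, hp⟩ := hG.exists_walk_length_eq_dist y z
  rw [← hp]
  exact key p

theorem Connected.dist_le_succ_of_adj (hG : G.Connected) {z z' : W} (h : G.Adj z z') (y : W) :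
    G.dist y z' ≤ G.dist y z + 1 := by
  have := hG.dist_triangle (u := y) (v := z) (w := z')
  rwa [SimpleGraph.dist_eq_one_iff_adj.2 h] at this

/-- `A` is a union of components of `G - u` that is joined to `u` by the single edge `ua`. -/
structure IsBranch (G : SimpleGraph W) (u a : W) (A : Set W) : Prop where
  adj : G.Adj u a
  mem : a ∈ A
  notMem : u ∉ A
  boundary : ∀ y ∈ A, ∀ z ∉ A, G.Adj y z → y = a ∧ z = u

/-- The graph obtained by replacing each edge between `u` and a vertex `c ∈ C` by the edge `ac`. -/
def reattach (G : SimpleGraph W) (u a : W) (C : Set W) : SimpleGraph W where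
  Adj y z := ((y ∈ C ↔ z ∈ C) ∧ G.Adj y z) ∨ (y ∈ C ∧ z ∉ C ∧ z = a ∧ G.Adj u y) ∨
    (z ∈ C ∧ y ∉ C ∧ y = a ∧ G.Adj u z)
  symm := ⟨fun y z h => by
    rcases h with h | h | h
    · exact Or.inl ⟨h.1.symm, h.2.symm⟩
    · exact Or.inr (Or.inr h)
    · exact Or.inr (Or.inl h)⟩
  loopless := ⟨fun y h => by
    rcases h with h | h | h
    · exact h.2.ne rfl
    · exact h.2.1 h.1
    · exact h.2.1 h.1⟩

theorem reattach_connected (hG : G.Connected) {u a : W} {A C : Set W} (hA : IsBranch G u a A)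
    (hAC : Disjoint A C) (huC : u ∉ C) (hC : ∀ y ∈ C, ∀ z ∉ C, G.Adj y z → z = u) :
    (reattach G u a C).Connected := by
  have haC : a ∉ C := Set.disjoint_left.1 hAC hA.mem
  have hua : (reattach G u a C).Adj u a := Or.inl ⟨by simp [huC, haC], hA.adj⟩
  have hcross : ∀ y z, y ∈ C → z ∉ C → G.Adj y z → (reattach G u a C).Reachable y z := by
    intro y z hy hz h
    obtain rfl := hC y hy z hz h
    have hya : (reattach G z a C).Adj y a := Or.inr (Or.inl ⟨hy, haC, rfl, h.symm⟩)
    exact hya.reachable.trans hua.symm.reachable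
  have hadj : ∀ y z, G.Adj y z → (reattach G u a C).Reachable y z := by
    intro y z h
    by_cases hy : y ∈ C <;> by_cases hz : z ∈ C
    · exact SimpleGraph.Adj.reachable (Or.inl ⟨by simp [hy, hz], h⟩)
    · exact hcross y z hy hz h
    · exact (hcross z y hz hy h.symm).symm
    · exact SimpleGraph.Adj.reachable (Or.inl ⟨by simp [hy, hz], h⟩)
  have := hG.nonempty
  refine ⟨fun y z => ?_⟩
  obtain ⟨p⟩ := hG.preconnected y z
  induction p with
  | nil => rfl
  | cons h _ ih => exact (hadj _ _ h).trans ih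

open Classical in
/-- A lower bound for the distances in `reattach G u a C`. -/
noncomputable def reattachBound (G : SimpleGraph W) (u : W) (A C : Set W) (y z : W) : ℤ :=
  if (y ∈ A ↔ z ∈ A) ∧ (y ∈ C ↔ z ∈ C) then G.dist y z
  else G.dist u y + G.dist u z +
    (if y ∈ C ∨ z ∈ C then (if y ∈ A ∨ z ∈ A then -1 else 1) else 0)

theorem reattachBound_le_dist (hG : G.Connected) {u a : W} {A C : Set W} (hA : IsBranch G u a A)
    (hAC : Disjoint A C) (huC : u ∉ C) (hC : ∀ y ∈ C, ∀ z ∉ C, G.Adj y z → z = u) (y z : W) :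
    reattachBound G u A C y z ≤ (reattach G u a C).dist y z := by
  have haC : a ∉ C := Set.disjoint_left.1 hAC hA.mem
  have hdj : ∀ w, w ∈ A → w ∉ C := fun w h => Set.disjoint_left.1 hAC h
  have h0 : reattachBound G u A C y y = 0 := by simp [reattachBound]
  have huA := hA.notMem
  have haA := hA.mem
  have huu : G.dist u u = 0 := SimpleGraph.dist_self
  have hua : G.dist u a = 1 := SimpleGraph.dist_eq_one_iff_adj.2 hA.adj
  have hyu : G.dist y u = G.dist u y := SimpleGraph.dist_comm
  have hya := Connected.dist_le_succ_of_adj hG hA.adj y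
  have hya' := Connected.dist_le_succ_of_adj hG hA.adj.symm y
  have hyA := hdj y
  have hattach : ∀ c ∈ C, G.Adj u c →
      reattachBound G u A C y c ≤ reattachBound G u A C y a + 1 ∧
      reattachBound G u A C y a ≤ reattachBound G u A C y c + 1 := by
    intro c hc huc
    have hcA : c ∉ A := fun h => hdj c h hc
    have hc1 : G.dist u c = 1 := SimpleGraph.dist_eq_one_iff_adj.2 huc
    have hyc := Connected.dist_le_succ_of_adj hG huc y
    have hyc' := Connected.dist_le_succ_of_adj hG huc.symm y
    simp only [reattachBound, hc, haC, haA, hcA, hua, hc1]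
    by_cases h1 : y ∈ A <;> by_cases h2 : y ∈ C <;> simp_all <;> omega
  have hlip : ∀ z z', (reattach G u a C).Adj z z' →
      reattachBound G u A C y z' ≤ reattachBound G u A C y z + 1 := by
    rintro z z' (⟨hzz, h⟩ | ⟨hz, -, rfl, h⟩ | ⟨hz, -, rfl, h⟩)
    · have e1 := Connected.dist_le_succ_of_adj hG h y
      have e2 := Connected.dist_le_succ_of_adj hG h u
      by_cases hs : z ∈ A ↔ z' ∈ A
      · by_cases h1 : y ∈ A <;> by_cases h2 : y ∈ C <;> by_cases h3 : z ∈ A <;>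
        by_cases h4 : z ∈ C <;>
        simp only [reattachBound, h1, h2, h3, h4, hs.1, hzz.1, mt hs.2, mt hzz.2, not_false_iff,
          and_self, or_self, if_true, if_false, true_iff, false_iff, not_true, and_false, false_and,
          or_true, or_false] <;> omega
      · have hb : (z = a ∧ z' = u) ∨ (z' = a ∧ z = u) := by
          by_cases hzA : z ∈ A
          · exact Or.inl (hA.boundary z hzA z' (fun h' => hs ⟨fun _ => h', fun _ => hzA⟩) h)
          · by_cases hzA' : z' ∈ A
            · exact Or.inr (hA.boundary z' hzA' z hzA h.symm)
            · exact absurd ⟨fun h' => absurd h' hzA, fun h' => absurd h' hzA'⟩ hs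
        rcases hb with ⟨rfl, rfl⟩ | ⟨rfl, rfl⟩ <;> simp only [reattachBound, huC, haC, huA, haA, hua] <;>
        by_cases h1 : y ∈ A <;> by_cases h2 : y ∈ C <;> simp_all <;> omega
    · exact (hattach z hz h).2
    · exact (hattach z' hz h).1
  have := le_add_dist_of_lipschitz (reattach_connected hG hA hAC huC hC) hlip y z
  rwa [h0, zero_add] at this

theorem two_mul_dist_le_dist_reattach_add (hG : G.Connected) {u a b : W} {A B C : Set W}
    (hA : IsBranch G u a A) (hB : IsBranch G u b B) (hAB : Disjoint A B)
    (hC : C = (A ∪ B ∪ {u})ᶜ) :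
    (reattach G u a C).Connected ∧ (reattach G u b C).Connected ∧
    (∀ y z, 2 * G.dist y z ≤ (reattach G u a C).dist y z + (reattach G u b C).dist y z) ∧
    ∀ c ∈ C, 2 * G.dist c u < (reattach G u a C).dist c u + (reattach G u b C).dist c u := by
  have hmem : ∀ z, z ∈ C ↔ z ∉ A ∧ z ∉ B ∧ z ≠ u := by simp [hC]; tauto
  have hAC : Disjoint A C := Set.disjoint_left.2 fun z h h' => ((hmem z).1 h').1 h
  have hBC : Disjoint B C := Set.disjoint_left.2 fun z h h' => ((hmem z).1 h').2.1 h
  have huC : u ∉ C := fun h => ((hmem u).1 h).2.2 rfl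
  have hbd : ∀ y ∈ C, ∀ z ∉ C, G.Adj y z → z = u := by
    intro y hy z hz h
    by_contra hzu
    have hy' := (hmem y).1 hy
    by_cases hzA : z ∈ A
    · exact hy'.2.2 (hA.boundary z hzA y hy'.1 h.symm).2
    · by_cases hzB : z ∈ B
      · exact hy'.2.2 (hB.boundary z hzB y hy'.2.1 h.symm).2
      · exact hz ((hmem z).2 ⟨hzA, hzB, hzu⟩)
  have b1 := reattachBound_le_dist hG hA hAC huC hbd
  have b2 := reattachBound_le_dist hG hB hBC huC hbd
  refine ⟨reattach_connected hG hA hAC huC hbd, reattach_connected hG hB hBC huC hbd,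
    fun y z => ?_, fun c hc => ?_⟩
  · have h1 := b1 y z
    have h2 := b2 y z
    have ht := hG.dist_triangle (u := y) (v := u) (w := z)
    rw [SimpleGraph.dist_comm (u := y) (v := u)] at ht
    have hcls : ∀ w, (w ∈ A ∧ w ∉ B ∧ w ∉ C) ∨ (w ∉ A ∧ w ∈ B ∧ w ∉ C) ∨
        (w ∉ A ∧ w ∉ B ∧ w ∈ C) ∨ (w ∉ A ∧ w ∉ B ∧ w ∉ C ∧ G.dist u w = 0) := by
      intro w
      by_cases hwA : w ∈ A
      · exact Or.inl ⟨hwA, Set.disjoint_left.1 hAB hwA, Set.disjoint_left.1 hAC hwA⟩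
      by_cases hwB : w ∈ B
      · exact Or.inr (Or.inl ⟨hwA, hwB, Set.disjoint_left.1 hBC hwB⟩)
      by_cases hwu : w = u
      · subst hwu
        exact Or.inr (Or.inr (Or.inr ⟨hwA, hwB, huC, SimpleGraph.dist_self⟩))
      · exact Or.inr (Or.inr (Or.inl ⟨hwA, hwB, (hmem w).2 ⟨hwA, hwB, hwu⟩⟩))
    rcases hcls y with ⟨y1, y2, y3⟩ | ⟨y1, y2, y3⟩ | ⟨y1, y2, y3⟩ | ⟨y1, y2, y3, y4⟩ <;>
    rcases hcls z with ⟨z1, z2, z3⟩ | ⟨z1, z2, z3⟩ | ⟨z1, z2, z3⟩ | ⟨z1, z2, z3, z4⟩ <;>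
    simp only [reattachBound, y1, y2, y3, z1, z2, z3, and_self, or_self, if_true, if_false,
      true_iff, false_iff, not_true, and_false, false_and, or_true, or_false] at h1 h2 <;> omega
  · have h1 := b1 c u
    have h2 := b2 c u
    have hc' := (hmem c).1 hc
    have hcomm : G.dist c u = G.dist u c := SimpleGraph.dist_comm
    simp only [reattachBound, hc, huC, hc'.1, hc'.2.1, hA.notMem, hB.notMem] at h1 h2
    simp at h1 h2
    omega

end Surgery

section Extremal

/-- `G` has a vertex of degree at least three. -/
def HasClaw {W : Type*} (G : SimpleGraph W) : Prop :=
  ∃ v x y z, G.Adj v x ∧ G.Adj v y ∧ G.Adj v z ∧ x ≠ y ∧ x ≠ z ∧ y ≠ z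

variable {W : Type*} {G : SimpleGraph W}

theorem isBranch_of_isAcyclic (hG : G.IsAcyclic) {u a : W} (h : G.Adj u a) :
    IsBranch G u a {z | (G.deleteEdges {s(u, a)}).Reachable a z} where
  adj := h
  mem := SimpleGraph.Reachable.refl a
  notMem := fun hu =>
    SimpleGraph.isBridge_iff.1 (SimpleGraph.isAcyclic_iff_forall_adj_isBridge.1 hG h) hu.symm
  boundary := by
    intro y hy z hz hyz
    by_cases he : s(y, z) = s(u, a)
    · rcases Sym2.eq_iff.1 he with ⟨-, rfl⟩ | h'
      · exact absurd (SimpleGraph.Reachable.refl _) hz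
      · exact h'
    · refine absurd (hy.trans (SimpleGraph.Adj.reachable ?_)) hz
      simpa [SimpleGraph.deleteEdges_adj, hyz] using he

theorem Connected.eq_univ_of_closed (hG : G.Connected) {S : Set W}
    (hS : ∀ y ∈ S, ∀ z, G.Adj y z → z ∈ S) {y : W} (hy : y ∈ S) (z : W) : z ∈ S := by
  obtain ⟨p⟩ := hG.preconnected y z
  induction p with
  | nil => exact hy
  | cons h _ ih => exact ih (hS _ hy _ h)

theorem IsBranch.disjoint (hG : G.Connected) {u a b : W} {A B : Set W} (hA : IsBranch G u a A)
    (hB : IsBranch G u b B) (hab : a ≠ b) : Disjoint A B := by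
  have hbA : b ∉ A := fun h => hab (hA.boundary b h u hA.notMem hB.adj.symm).1.symm
  have haB : a ∉ B := fun h => hab (hB.boundary a h u hB.notMem hA.adj.symm).1
  refine Set.disjoint_left.2 fun w hwA hwB => hA.notMem ?_
  refine (Connected.eq_univ_of_closed hG (S := A ∩ B) ?_ ⟨hwA, hwB⟩ u).1
  rintro y ⟨hyA, hyB⟩ z hyz
  by_contra hz
  by_cases hzA : z ∈ A
  · by_cases hzB : z ∈ B
    · exact hz ⟨hzA, hzB⟩
    · exact hbA ((hB.boundary y hyB z hzB hyz).1 ▸ hyA)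
  · exact haB ((hA.boundary y hyA z hzA hyz).1 ▸ hyB)

theorem IsBranch.notMem_of_adj {u a c : W} {A : Set W} (hA : IsBranch G u a A) (h : G.Adj u c)
    (hca : c ≠ a) : c ∉ A := fun hc => hca (hA.boundary c hc u hA.notMem h.symm).1

theorem hasClaw_reattach_of_two {u a c c' : W} {A C : Set W} (hA : IsBranch G u a A)
    (hAC : Disjoint A C) (huC : u ∉ C) (hc : c ∈ C) (hc' : c' ∈ C) (h : G.Adj u c)
    (h' : G.Adj u c') (hne : c ≠ c') : HasClaw (reattach G u a C) := by
  have haC : a ∉ C := Set.disjoint_left.1 hAC hA.mem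
  refine ⟨a, u, c, c', Or.inl ⟨by simp [huC, haC], hA.adj.symm⟩, Or.inr (Or.inr ⟨hc, haC, rfl, h⟩),
    Or.inr (Or.inr ⟨hc', haC, rfl, h'⟩), h.ne, h'.ne, hne⟩

theorem hasClaw_reattach_of_adj {u a a' c : W} {A C : Set W} (hA : IsBranch G u a A)
    (hAC : Disjoint A C) (huC : u ∉ C) (hc : c ∈ C) (h : G.Adj u c) (h' : G.Adj a a')
    (hne : a' ≠ u) : HasClaw (reattach G u a C) := by
  have haC : a ∉ C := Set.disjoint_left.1 hAC hA.mem
  have ha'A : a' ∈ A := by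
    by_contra h''
    exact hne (hA.boundary a hA.mem a' h'' h').2
  have ha'C : a' ∉ C := Set.disjoint_left.1 hAC ha'A
  refine ⟨a, u, a', c, Or.inl ⟨by simp [huC, haC], hA.adj.symm⟩, Or.inl ⟨by simp [ha'C, haC], h'⟩,
    Or.inr (Or.inr ⟨hc, haC, rfl, h⟩), hne.symm, h.ne, fun e => ha'C (e ▸ hc)⟩

theorem hasClaw_reattach_of_leaf {u a v x y z : W} {A C : Set W} (hA : IsBranch G u a A)
    (hAC : Disjoint A C) (hC : ∀ y ∈ C, ∀ z ∉ C, G.Adj y z → z = u) (huC : u ∉ C)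
    (hleaf : ∀ w, G.Adj a w → w = u) (hv : v ∈ C) (hx : G.Adj v x) (hy : G.Adj v y)
    (hz : G.Adj v z) (hxy : x ≠ y) (hxz : x ≠ z) (hyz : y ≠ z) :
    HasClaw (reattach G u a C) := by
  classical
  have haC : a ∉ C := Set.disjoint_left.1 hAC hA.mem
  have hvu : v ≠ u := fun h => huC (h ▸ hv)
  have hna : ∀ w, G.Adj v w → w ≠ a := by
    rintro w hw rfl
    exact hvu (hleaf v hw.symm)
  have hadj : ∀ w, G.Adj v w → (reattach G u a C).Adj v (if w = u then a else w) := by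
    intro w hw
    by_cases hwu : w = u
    · subst hwu
      rw [if_pos rfl]
      exact Or.inr (Or.inl ⟨hv, haC, rfl, hw.symm⟩)
    · have hwC : w ∈ C := by
        by_contra h
        exact hwu (hC v hv w h hw)
      rw [if_neg hwu]
      exact Or.inl ⟨by simp [hv, hwC], hw⟩
  have hinj : ∀ w w', G.Adj v w → G.Adj v w' → w ≠ w' →
      (if w = u then a else w) ≠ (if w' = u then a else w') := by
    intro w w' hw hw' hne
    have h1 := hna w hw
    have h2 := hna w' hw'
    by_cases e1 : w = u <;> by_cases e2 : w' = u <;> simp [e1, e2]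
    · exact absurd (e1.trans e2.symm) hne
    · exact h2.symm
    · exact h1
    · exact hne
  exact ⟨v, _, _, _, hadj x hx, hadj y hy, hadj z hz, hinj x y hx hy hxy, hinj x z hx hz hxz,
    hinj y z hy hz hyz⟩

variable [Fintype W]

/-- `G` has maximal energy among the connected graphs with a vertex of degree at least three. -/
structure IsExtremal (G : SimpleGraph W) (α : ℝ) (x : W → ℝ) : Prop where
  connected : G.Connected
  hasClaw : HasClaw G
  energy_le : ∀ H : SimpleGraph W, H.Connected → HasClaw H → energy H α x ≤ energy G α x

theorem exists_isExtremal {G : SimpleGraph W} (hG : G.Connected) (hc : HasClaw G) (α : ℝ)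
    (x : W → ℝ) : ∃ H : SimpleGraph W, IsExtremal H α x := by
  obtain ⟨H, hH, hmax⟩ := Set.Finite.exists_maximalFor (fun H : SimpleGraph W => energy H α x)
    {H | H.Connected ∧ HasClaw H} (Set.toFinite _) ⟨G, hG, hc⟩
  refine ⟨H, hH.1, hH.2, fun K hK hK' => ?_⟩
  rcases le_total (energy K α x) (energy H α x) with h | h
  · exact h
  · exact hmax ⟨hK, hK'⟩ h

namespace IsExtremal

variable {α : ℝ} {x : W → ℝ}

theorem isTree (hα0 : 0 ≤ α) (hα1 : α < 1) (hx : ∀ i, 0 < x i) (hG : IsExtremal G α x) :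
    G.IsTree := by
  obtain ⟨u, p, q, r, hp, hq, hr, hpq, hpr, hqr⟩ := hG.hasClaw
  obtain ⟨T, hST, hTG, hT⟩ := hG.connected.exists_isTree_le_of_le_of_isAcyclic
    (H := G ⊓ SimpleGraph.starGraph u) inf_le_left
    ((SimpleGraph.isTree_starGraph u).isAcyclic.anti inf_le_right)
  have hstar : ∀ w, G.Adj u w → T.Adj u w := fun w hw =>
    hST ⟨hw, SimpleGraph.starGraph_adj.2 ⟨hw.ne, Or.inl rfl⟩⟩
  have hle := hG.energy_le T hT.connected
    ⟨u, p, q, r, hstar p hp, hstar q hq, hstar r hr, hpq, hpr, hqr⟩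
  suffices G ≤ T by rwa [le_antisymm this hTG]
  intro y z hyz
  by_contra hTyz
  refine absurd hle (not_le.2 (energy_lt_energy hα0 hα1 hx (fun a b =>
    (hT.connected.preconnected a b).dist_anti hTG) ⟨y, z, ?_⟩))
  rw [SimpleGraph.dist_eq_one_iff_adj.2 hyz]
  exact hT.connected.one_lt_dist_of_ne_of_not_adj hyz.ne hTyz

theorem not_hasClaw_reattach (hα0 : 0 ≤ α) (hα1 : α < 1) (hx : ∀ i, 0 < x i)
    (hG : IsExtremal G α x) {u a b c : W} {A B C : Set W} (hA : IsBranch G u a A)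
    (hB : IsBranch G u b B) (hab : a ≠ b) (hC : C = (A ∪ B ∪ {u})ᶜ) (hc : c ∈ C)
    (h1 : HasClaw (reattach G u a C)) (h2 : HasClaw (reattach G u b C)) : False := by
  obtain ⟨c1, c2, hle, hlt⟩ := two_mul_dist_le_dist_reattach_add hG.connected hA hB
    (hA.disjoint hG.connected hB hab) hC
  rcases energy_lt_or_energy_lt (Equiv.refl W) (Equiv.refl W) hα0 hα1 hx hle ⟨c, u, hlt c hc⟩
    with h | h
  · exact absurd (hG.energy_le _ c1 h1) (not_le.2 h)
  · exact absurd (hG.energy_le _ c2 h2) (not_le.2 h)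

theorem exists_structure (hα0 : 0 ≤ α) (hα1 : α < 1) (hx : ∀ i, 0 < x i)
    (hG : IsExtremal G α x) :
    ∃ u a b c, a ≠ b ∧ a ≠ c ∧ b ≠ c ∧ (∀ w, G.Adj u w ↔ w = a ∨ w = b ∨ w = c) ∧
      (∀ w, G.Adj a w → w = u) ∧ (∀ w, G.Adj b w → w = u) ∧
      ∀ v ≠ u, ∀ p q r, G.Adj v p → G.Adj v q → G.Adj v r → p = q ∨ p = r ∨ q = r := by
  have hT := isTree hα0 hα1 hx hG
  have hconn := hG.connected
  have hbr : ∀ u a, G.Adj u a → ∃ A, IsBranch G u a A := fun u a h =>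
    ⟨_, isBranch_of_isAcyclic hT.isAcyclic h⟩
  -- the data attached to a pair of branches at `u`
  have hsetup : ∀ u a b, G.Adj u a → G.Adj u b → a ≠ b → ∃ A B C : Set W, IsBranch G u a A ∧
      IsBranch G u b B ∧ C = (A ∪ B ∪ {u})ᶜ ∧ Disjoint A C ∧ Disjoint B C ∧ u ∉ C ∧
      (∀ c, G.Adj u c → c ≠ a → c ≠ b → c ∈ C) := by
    intro u a b ha hb hab
    obtain ⟨A, hA⟩ := hbr u a ha
    obtain ⟨B, hB⟩ := hbr u b hb
    refine ⟨A, B, _, hA, hB, rfl, ?_, ?_, by simp, fun c hc hca hcb => ?_⟩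
    · exact Set.disjoint_left.2 fun z hz hz' => hz' (Or.inl (Or.inl hz))
    · exact Set.disjoint_left.2 fun z hz hz' => hz' (Or.inl (Or.inr hz))
    · rintro ((h | h) | h)
      · exact hA.notMem_of_adj hc hca h
      · exact hB.notMem_of_adj hc hcb h
      · exact hc.ne h.symm
  have hdeg : ∀ u a b c d, G.Adj u a → G.Adj u b → G.Adj u c → G.Adj u d → a ≠ b → a ≠ c →
      b ≠ c → d = a ∨ d = b ∨ d = c := by
    intro u a b c d ha hb hc hd hab hac hbc
    by_contra! hne
    obtain ⟨A, B, C, hA, hB, hC, hAC, hBC, huC, hmem⟩ := hsetup u a b ha hb hab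
    have hcC := hmem c hc hac.symm hbc.symm
    have hdC := hmem d hd hne.1 hne.2.1
    exact not_hasClaw_reattach hα0 hα1 hx hG hA hB hab hC hcC
      (hasClaw_reattach_of_two hA hAC huC hcC hdC hc hd hne.2.2.symm)
      (hasClaw_reattach_of_two hB hBC huC hcC hdC hc hd hne.2.2.symm)
  have hleaf : ∀ u a b c, G.Adj u a → G.Adj u b → G.Adj u c → a ≠ b → a ≠ c → b ≠ c →
      (∀ w, G.Adj a w → w = u) ∨ (∀ w, G.Adj b w → w = u) := by
    intro u a b c ha hb hc hab hac hbc
    by_contra! hne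
    obtain ⟨⟨a', ha', hau⟩, b', hb', hbu⟩ := hne
    obtain ⟨A, B, C, hA, hB, hC, hAC, hBC, huC, hmem⟩ := hsetup u a b ha hb hab
    have hcC := hmem c hc hac.symm hbc.symm
    exact not_hasClaw_reattach hα0 hα1 hx hG hA hB hab hC hcC
      (hasClaw_reattach_of_adj hA hAC huC hcC hc ha' hau)
      (hasClaw_reattach_of_adj hB hBC huC hcC hc hb' hbu)
  have hmain : ∀ u a b c, G.Adj u a → G.Adj u b → G.Adj u c → a ≠ b → a ≠ c → b ≠ c →
      (∀ w, G.Adj a w → w = u) → (∀ w, G.Adj b w → w = u) →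
      ∀ v ≠ u, ∀ p q r, G.Adj v p → G.Adj v q → G.Adj v r → p = q ∨ p = r ∨ q = r := by
    intro u a b c ha hb hc hab hac hbc hla hlb v hvu p q r hp hq hr
    by_contra! hne
    obtain ⟨A, B, C, hA, hB, hC, hAC, hBC, huC, hmem⟩ := hsetup u a b ha hb hab
    have hcC := hmem c hc hac.symm hbc.symm
    have hsingle : ∀ {s S}, IsBranch G u s S → (∀ w, G.Adj s w → w = u) → v ∈ S → v = s := by
      intro s S hS hls hvS
      by_contra hvs
      have hcl : ∀ y ∈ S \ {s}, ∀ z, G.Adj y z → z ∈ S \ {s} := by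
        rintro y ⟨hyS, hys⟩ z hyz
        refine ⟨by_contra fun hz => hys (hS.boundary y hyS z hz hyz).1, ?_⟩
        rintro rfl
        exact hS.notMem (hls y hyz.symm ▸ hyS)
      exact (Connected.eq_univ_of_closed hconn hcl ⟨hvS, hvs⟩ s).2 rfl
    have hvC : v ∈ C := by
      rw [hC]
      rintro ((h | h) | h)
      · obtain rfl := hsingle hA hla h
        exact hne.1 ((hla p hp).trans (hla q hq).symm)
      · obtain rfl := hsingle hB hlb h
        exact hne.1 ((hlb p hp).trans (hlb q hq).symm)
      · exact hvu h
    have hbd : ∀ y ∈ C, ∀ z ∉ C, G.Adj y z → z = u := by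
      intro y hy z hz h
      rw [hC] at hy hz
      by_contra hzu
      have hz' : z ∈ A ∪ B := by
        by_contra h'
        exact hz fun h'' => h''.elim h' hzu
      rcases hz' with h' | h'
      · exact hy (Or.inr (hA.boundary z h' y (fun e => hy (Or.inl (Or.inl e))) h.symm).2)
      · exact hy (Or.inr (hB.boundary z h' y (fun e => hy (Or.inl (Or.inr e))) h.symm).2)
    exact not_hasClaw_reattach hα0 hα1 hx hG hA hB hab hC hcC
      (hasClaw_reattach_of_leaf hA hAC hbd huC hla hvC hp hq hr hne.1 hne.2.1 hne.2.2)
      (hasClaw_reattach_of_leaf hB hBC hbd huC hlb hvC hp hq hr hne.1 hne.2.1 hne.2.2)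
  have hfinish : ∀ u a b c, G.Adj u a → G.Adj u b → G.Adj u c → a ≠ b → a ≠ c → b ≠ c →
      (∀ w, G.Adj a w → w = u) → (∀ w, G.Adj b w → w = u) →
      ∃ u a b c, a ≠ b ∧ a ≠ c ∧ b ≠ c ∧ (∀ w, G.Adj u w ↔ w = a ∨ w = b ∨ w = c) ∧
      (∀ w, G.Adj a w → w = u) ∧ (∀ w, G.Adj b w → w = u) ∧
      ∀ v ≠ u, ∀ p q r, G.Adj v p → G.Adj v q → G.Adj v r → p = q ∨ p = r ∨ q = r := by
    intro u a b c ha hb hc hab hac hbc hla hlb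
    refine ⟨u, a, b, c, hab, hac, hbc, fun w => ⟨fun hw =>
      hdeg u a b c w ha hb hc hw hab hac hbc, ?_⟩, hla, hlb,
      hmain u a b c ha hb hc hab hac hbc hla hlb⟩
    rintro (rfl | rfl | rfl) <;> assumption
  obtain ⟨u, p, q, r, hp, hq, hr, hpq, hpr, hqr⟩ := hG.hasClaw
  rcases hleaf u p q r hp hq hr hpq hpr hqr with h1 | h1
  · rcases hleaf u q r p hq hr hp hqr hpq.symm hpr.symm with h2 | h2
    · exact hfinish u p q r hp hq hr hpq hpr hqr h1 h2
    · exact hfinish u p r q hp hr hq hpr hpq hqr.symm h1 h2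
  · rcases hleaf u p r q hp hr hq hpr hpq hqr.symm with h2 | h2
    · exact hfinish u p q r hp hq hr hpq hpr hqr h2 h1
    · exact hfinish u q r p hq hr hp hqr hpq.symm hpr.symm h1 h2

end IsExtremal

end Extremal

section Layers

variable {W : Type*} {G : SimpleGraph W}

theorem Connected.exists_adj_dist_eq (hG : G.Connected) {u z : W} (h : z ≠ u) :
    ∃ z', G.Adj z z' ∧ G.dist u z = G.dist u z' + 1 := by
  obtain ⟨p, hp⟩ := hG.exists_walk_length_eq_dist z u
  cases p with
  | nil => exact absurd rfl h
  | cons hadj q =>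
    rename_i w
    refine ⟨w, hadj, ?_⟩
    have h1 := SimpleGraph.dist_le q
    have h2 := Connected.dist_le_succ_of_adj hG hadj.symm u
    rw [SimpleGraph.Walk.length_cons] at hp
    have h3 : G.dist z u = G.dist u z := SimpleGraph.dist_comm
    have h4 : G.dist w u = G.dist u w := SimpleGraph.dist_comm
    omega

/-- `G` is a path starting at `u`, apart from some vertices outside `S` attached to `u`. -/
structure IsTail (G : SimpleGraph W) (u : W) (S : Finset W) : Prop where
  connected : G.Connected
  mem : u ∈ S
  root : ∀ y ∈ S, ∀ z ∈ S, G.Adj u y → G.Adj u z → y = z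
  degree : ∀ v ≠ u, ∀ p q r, G.Adj v p → G.Adj v q → G.Adj v r → p = q ∨ p = r ∨ q = r
  pendant : ∀ w ∉ S, ∀ z, G.Adj w z → z = u

namespace IsTail

variable {u : W} {S : Finset W}

theorem mem_of_adj (h : IsTail G u S) {z z' : W} (hz : z ≠ u) (hadj : G.Adj z z') : z' ∈ S := by
  by_contra h'
  exact hz (h.pendant z' h' z hadj.symm)

theorem dist_injOn (h : IsTail G u S) {y z : W} (hy : y ∈ S) (hz : z ∈ S)
    (hyz : G.dist u y = G.dist u z) : y = z := by
  have hzero : ∀ w, G.dist u w = 0 → w = u := fun w hw => (h.connected.dist_eq_zero_iff.1 hw).symm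
  have key : ∀ k, ∀ y ∈ S, ∀ z ∈ S, G.dist u y = k → G.dist u z = k → y = z := by
    intro k
    induction k with
    | zero => exact fun y _ z _ h1 h2 => (hzero y h1).trans (hzero z h2).symm
    | succ k ih =>
      intro y hy z hz h1 h2
      have hyu : y ≠ u := by rintro rfl; simp at h1
      have hzu : z ≠ u := by rintro rfl; simp at h2
      obtain ⟨y', hyy', hy'⟩ := Connected.exists_adj_dist_eq h.connected hyu
      obtain ⟨z', hzz', hz'⟩ := Connected.exists_adj_dist_eq h.connected hzu
      obtain rfl := ih y' (h.mem_of_adj hyu hyy') z' (h.mem_of_adj hzu hzz') (by omega) (by omega)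
      by_cases hu : y' = u
      · subst hu
        exact h.root y hy z hz hyy'.symm hzz'.symm
      · obtain ⟨w, hw, hw'⟩ := Connected.exists_adj_dist_eq h.connected hu
        rcases h.degree y' hu y z w hyy'.symm hzz'.symm hw with e | e | e
        · exact e
        · subst e; omega
        · subst e; omega
  exact key _ y hy z hz rfl hyz.symm

theorem adj_iff (h : IsTail G u S) {y z : W} (hy : y ∈ S) (hz : z ∈ S) :
    G.Adj y z ↔ G.dist u y + 1 = G.dist u z ∨ G.dist u z + 1 = G.dist u y := by
  have key : ∀ y ∈ S, ∀ z ∈ S, G.dist u y + 1 = G.dist u z → G.Adj y z := by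
    intro y hy z hz hd
    have hzu : z ≠ u := by rintro rfl; simp at hd
    obtain ⟨z', hzz', hz'⟩ := Connected.exists_adj_dist_eq h.connected hzu
    obtain rfl := h.dist_injOn hy (h.mem_of_adj hzu hzz') (by omega)
    exact hzz'.symm
  refine ⟨fun hadj => ?_, ?_⟩
  · have h1 := Connected.dist_le_succ_of_adj h.connected hadj u
    have h2 := Connected.dist_le_succ_of_adj h.connected hadj.symm u
    have h3 : G.dist u y ≠ G.dist u z := fun e => hadj.ne (h.dist_injOn hy hz e)
    omega
  · rintro (hd | hd)
    · exact key y hy z hz hd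
    · exact (key z hz y hy hd).symm

theorem dist_lt_card (h : IsTail G u S) {v : W} (hv : v ∈ S) : G.dist u v < S.card := by
  classical
  have key : ∀ k, ∀ v ∈ S, G.dist u v = k →
      Finset.range (k + 1) ⊆ S.image fun w => G.dist u w := by
    intro k
    induction k with
    | zero =>
      intro v hv hd
      rw [Finset.range_one, Finset.singleton_subset_iff]
      exact Finset.mem_image.2 ⟨v, hv, hd⟩
    | succ k ih =>
      intro v hv hd
      have hvu : v ≠ u := by rintro rfl; simp at hd
      obtain ⟨w, hw, hw'⟩ := Connected.exists_adj_dist_eq h.connected hvu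
      rw [Finset.range_add_one]
      exact Finset.insert_subset (Finset.mem_image.2 ⟨v, hv, hd⟩)
        (ih w (h.mem_of_adj hvu hw) (by omega))
  have h1 := Finset.card_le_card (key _ v hv rfl)
  rw [Finset.card_range] at h1
  exact lt_of_lt_of_le h1 Finset.card_image_le

end IsTail

theorem nonempty_iso_pathGraph [Fintype W] {n : ℕ} (hcard : Fintype.card W = n) {u : W}
    (h : IsTail G u Finset.univ) : Nonempty (G ≃g SimpleGraph.pathGraph n) := by
  let f : W → Fin n := fun v =>
    ⟨G.dist u v, by rw [← hcard]; exact h.dist_lt_card (Finset.mem_univ v)⟩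
  have hf : Function.Bijective f := by
    rw [Fintype.bijective_iff_injective_and_card]
    refine ⟨fun y z hyz => ?_, by simp [hcard]⟩
    exact h.dist_injOn (Finset.mem_univ y) (Finset.mem_univ z) (congrArg Fin.val hyz)
  refine ⟨⟨Equiv.ofBijective f hf, fun {y z} => ?_⟩⟩
  rw [h.adj_iff (Finset.mem_univ y) (Finset.mem_univ z), SimpleGraph.pathGraph_adj]
  rfl

theorem broom_adj {n : ℕ} (hn : 4 ≤ n) (i j : Fin n) : (broom n).Adj i j ↔
    (i.val + 1 = j.val ∧ j.val ≤ n - 3) ∨ (j.val + 1 = i.val ∧ i.val ≤ n - 3) ∨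
    (i.val = n - 3 ∧ n - 2 ≤ j.val) ∨ (j.val = n - 3 ∧ n - 2 ≤ i.val) := by
  have hi := i.isLt
  have hj := j.isLt
  rw [broom, SimpleGraph.fromRel_adj, ne_eq, Fin.ext_iff]
  omega

theorem nonempty_iso_broom [Fintype W] {n : ℕ} (hn : 4 ≤ n) (hcard : Fintype.card W = n)
    (hG : G.Connected) {u a b c : W} (hab : a ≠ b)
    (hu : ∀ w, G.Adj u w ↔ w = a ∨ w = b ∨ w = c) (ha : ∀ w, G.Adj a w → w = u)
    (hb : ∀ w, G.Adj b w → w = u)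
    (hdeg : ∀ v ≠ u, ∀ p q r, G.Adj v p → G.Adj v q → G.Adj v r → p = q ∨ p = r ∨ q = r) :
    Nonempty (G ≃g broom n) := by
  classical
  have hua : G.Adj u a := (hu a).2 (Or.inl rfl)
  have hub : G.Adj u b := (hu b).2 (Or.inr (Or.inl rfl))
  set S : Finset W := {a, b}ᶜ with hS
  have hmem : ∀ w, w ∈ S ↔ w ≠ a ∧ w ≠ b := by simp [hS]
  have hSc : S.card = n - 2 := by rw [hS, Finset.card_compl, hcard, Finset.card_pair hab]
  have h : IsTail G u S := by
    refine ⟨hG, (hmem u).2 ⟨hua.ne, hub.ne⟩, fun y hy z hz h1 h2 => ?_, hdeg, fun w hw z hz => ?_⟩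
    · have h3 := (hmem y).1 hy
      have h4 := (hmem z).1 hz
      have h5 := (hu y).1 h1
      have h6 := (hu z).1 h2
      simp only [h3.1, h3.2, h4.1, h4.2, false_or] at h5 h6
      rw [h5, h6]
    · by_cases hwa : w = a
      · exact ha z (hwa ▸ hz)
      · by_cases hwb : w = b
        · exact hb z (hwb ▸ hz)
        · exact absurd ((hmem w).2 ⟨hwa, hwb⟩) hw
  let f : W → Fin n := fun v =>
    if v = a then ⟨n - 2, by omega⟩ else if v = b then ⟨n - 1, by omega⟩
    else ⟨n - 3 - G.dist u v, by omega⟩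
  have fa : (f a).val = n - 2 := by simp [f]
  have fb : (f b).val = n - 1 := by simp [f, hab.symm]
  have fS : ∀ v ∈ S, (f v).val = n - 3 - G.dist u v ∧ G.dist u v ≤ n - 3 := by
    intro v hv
    have h1 := (hmem v).1 hv
    have h2 := h.dist_lt_card hv
    exact ⟨by simp [f, h1.1, h1.2], by omega⟩
  have hcases : ∀ v, v = a ∨ v = b ∨ v ∈ S := fun v => by rw [hmem]; tauto
  have hf : Function.Bijective f := by
    rw [Fintype.bijective_iff_injective_and_card]
    refine ⟨fun y z hyz => ?_, by simp [hcard]⟩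
    have hyz := congrArg Fin.val hyz
    rcases hcases y with rfl | rfl | hy <;> rcases hcases z with rfl | rfl | hz
    · rfl
    · omega
    · have := fS z hz; omega
    · omega
    · rfl
    · have := fS z hz; omega
    · have := fS y hy; omega
    · have := fS y hy; omega
    · have h1 := fS y hy
      have h2 := fS z hz
      exact h.dist_injOn hy hz (by omega)
  have hleaf : ∀ {w}, G.Adj u w → (∀ z, G.Adj w z → z = u) → n - 2 ≤ (f w).val → ∀ z ∈ S,
      ((broom n).Adj (f w) (f z) ↔ G.Adj w z) := by
    intro w huw hw hfw z hz
    have h1 := fS z hz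
    have h2 : G.Adj w z ↔ G.dist u z = 0 := by
      rw [hG.dist_eq_zero_iff]
      exact ⟨fun e => (hw z e).symm, fun e => e ▸ huw.symm⟩
    rw [h2, broom_adj hn]
    omega
  have hnab : ¬ G.Adj a b := fun e => hub.ne (ha b e).symm
  refine ⟨⟨Equiv.ofBijective f hf, fun {y z} => ?_⟩⟩
  change (broom n).Adj (f y) (f z) ↔ G.Adj y z
  have hla := hleaf hua ha (by omega)
  have hlb := hleaf hub hb (by omega)
  rcases hcases y with rfl | rfl | hy <;> rcases hcases z with rfl | rfl | hz
  · simp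
  · simp only [hnab, iff_false, broom_adj hn]
    omega
  · exact hla z hz
  · simp only [mt SimpleGraph.Adj.symm hnab, iff_false, broom_adj hn]
    omega
  · simp
  · exact hlb z hz
  · rw [SimpleGraph.adj_comm, hla y hy, SimpleGraph.adj_comm]
  · rw [SimpleGraph.adj_comm, hlb y hy, SimpleGraph.adj_comm]
  · have h1 := fS y hy
    have h2 := fS z hz
    rw [h.adj_iff hy hz, broom_adj hn]
    omega

theorem IsExtremal.nonempty_iso_broom [Fintype W] {n : ℕ} (hn : 4 ≤ n)
    (hcard : Fintype.card W = n) {α : ℝ} (hα0 : 0 ≤ α) (hα1 : α < 1) {x : W → ℝ}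
    (hx : ∀ i, 0 < x i) (hG : IsExtremal G α x) : Nonempty (G ≃g broom n) := by
  obtain ⟨u, a, b, c, hab, -, -, hu, ha, hb, hdeg⟩ := hG.exists_structure hα0 hα1 hx
  exact DistAlpha.nonempty_iso_broom hn hcard hG.connected hab hu ha hb hdeg

end Layers

section Chain

variable {n N : ℕ} {H : SimpleGraph (Fin n)}

theorem exists_walk_of_chain
    (hH : ∀ i j : Fin n, i.val + 1 = j.val → j.val ≤ N → H.Adj i j) (d : ℕ) :
    ∀ i j : Fin n, i.val + d = j.val → j.val ≤ N → ∃ p : H.Walk i j, p.length = d := by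
  induction d with
  | zero =>
    intro i j hij _
    obtain rfl : i = j := Fin.ext hij
    exact ⟨.nil, rfl⟩
  | succ d ih =>
    intro i j hij hj
    have hlt := j.isLt
    let k : Fin n := ⟨i.val + 1, by omega⟩
    have hk : k.val = i.val + 1 := rfl
    obtain ⟨p, hp⟩ := ih k j (by omega) hj
    exact ⟨.cons (hH i k rfl (by omega)) p, by simp [hp]⟩

theorem dist_le_of_chain
    (hH : ∀ i j : Fin n, i.val + 1 = j.val → j.val ≤ N → H.Adj i j) {i j : Fin n}
    (hij : i ≤ j) (hj : j.val ≤ N) : H.dist i j ≤ j.val - i.val := by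
  obtain ⟨p, hp⟩ := exists_walk_of_chain hH (j.val - i.val) i j (by omega) hj
  exact hp ▸ SimpleGraph.dist_le p

theorem le_pathGraph_dist (i j : Fin n) :
    (i.val - j.val) + (j.val - i.val) ≤ (SimpleGraph.pathGraph n).dist i j := by
  have hn : n = (n - 1) + 1 := by have := i.isLt; omega
  have hconn : (SimpleGraph.pathGraph n).Connected := by
    rw [hn]
    exact SimpleGraph.pathGraph_connected _
  have hlip : ∀ z z' : Fin n, (SimpleGraph.pathGraph n).Adj z z' → (z'.val : ℤ) ≤ z.val + 1 := by
    intro z z' h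
    rw [SimpleGraph.pathGraph_adj] at h
    omega
  have h1 := le_add_dist_of_lipschitz hconn (f := fun z => (z.val : ℤ)) hlip i j
  have h2 := le_add_dist_of_lipschitz hconn (f := fun z => (z.val : ℤ)) hlip j i
  rw [SimpleGraph.dist_comm] at h2
  omega

end Chain

section Broom

variable {n : ℕ}

/-- The distance between the vertices numbered `i` and `j` of `broom n`. -/
def broomDist (n i j : ℕ) : ℕ :=
  if i = j then 0 else if n - 2 ≤ i ∧ n - 2 ≤ j then 2 else
    (min i (n - 2) - min j (n - 2)) + (min j (n - 2) - min i (n - 2))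

theorem broomDist_comm (n i j : ℕ) : broomDist n i j = broomDist n j i := by
  unfold broomDist
  split_ifs <;> omega

theorem broom_adj_of_chain (hn : 4 ≤ n) (i j : Fin n) (hij : i.val + 1 = j.val)
    (hj : j.val ≤ n - 3) : (broom n).Adj i j := by
  rw [broom_adj hn]
  omega

theorem exists_broom_walk (hn : 4 ≤ n) {i j : Fin n} (hij : i ≤ j) :
    ∃ p : (broom n).Walk i j, p.length = broomDist n i j := by
  have hij : i.val ≤ j.val := hij
  have hi := i.isLt
  have hj := j.isLt
  let c : Fin n := ⟨n - 3, by omega⟩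
  have hc : c.val = n - 3 := rfl
  by_cases hjn : j.val ≤ n - 3
  · obtain ⟨p, hp⟩ := exists_walk_of_chain (broom_adj_of_chain hn) (j.val - i.val) i j
      (by omega) hjn
    refine ⟨p, ?_⟩
    rw [hp, broomDist]
    split_ifs <;> omega
  have hcj : (broom n).Adj c j := by
    rw [broom_adj hn]
    omega
  by_cases hin : i.val ≤ n - 3
  · obtain ⟨p, hp⟩ := exists_walk_of_chain (broom_adj_of_chain hn) (n - 3 - i.val) i c
      (by omega) le_rfl
    refine ⟨p.concat hcj, ?_⟩
    rw [SimpleGraph.Walk.length_concat, hp, broomDist]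
    split_ifs <;> omega
  have hci : (broom n).Adj i c := by
    rw [broom_adj hn]
    omega
  by_cases h : i = j
  · subst h
    exact ⟨.nil, by simp [broomDist]⟩
  · have h' : i.val ≠ j.val := fun e => h (Fin.ext e)
    refine ⟨.cons hci (.cons hcj .nil), ?_⟩
    simp only [SimpleGraph.Walk.length_cons, SimpleGraph.Walk.length_nil, broomDist]
    split_ifs <;> omega

theorem broom_connected (hn : 4 ≤ n) : (broom n).Connected := by
  have : Nonempty (Fin n) := ⟨⟨0, by omega⟩⟩
  refine ⟨fun i j => ?_⟩
  rcases le_total i j with h | h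
  · obtain ⟨p, -⟩ := exists_broom_walk hn h
    exact ⟨p⟩
  · obtain ⟨p, -⟩ := exists_broom_walk hn h
    exact ⟨p.reverse⟩

theorem broom_dist_le (hn : 4 ≤ n) (i j : Fin n) : (broom n).dist i j ≤ broomDist n i j := by
  rcases le_total i j with h | h
  · obtain ⟨p, hp⟩ := exists_broom_walk hn h
    exact hp ▸ SimpleGraph.dist_le p
  · obtain ⟨p, hp⟩ := exists_broom_walk hn h
    rw [SimpleGraph.dist_comm, broomDist_comm]
    exact hp ▸ SimpleGraph.dist_le p

theorem le_broom_dist (hn : 4 ≤ n) (i j : Fin n) : broomDist n i j ≤ (broom n).dist i j := by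
  have hconn := broom_connected hn
  have hi := i.isLt
  have hj := j.isLt
  have hlip : ∀ z z' : Fin n, (broom n).Adj z z' →
      ((min z'.val (n - 2) : ℕ) : ℤ) ≤ (min z.val (n - 2) : ℕ) + 1 := by
    intro z z' h
    rw [broom_adj hn] at h
    omega
  have h1 := le_add_dist_of_lipschitz hconn (f := fun z => ((min z.val (n - 2) : ℕ) : ℤ)) hlip i j
  have h2 := le_add_dist_of_lipschitz hconn (f := fun z => ((min z.val (n - 2) : ℕ) : ℤ)) hlip j i
  rw [SimpleGraph.dist_comm] at h2
  have h3 : i.val ≠ j.val → n - 2 ≤ i.val → n - 2 ≤ j.val → 2 ≤ (broom n).dist i j := by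
    intro hne hin hjn
    have h0 : (broom n).dist i j ≠ 0 := fun h => hne (by rw [hconn.dist_eq_zero_iff.1 h])
    have h1 : (broom n).dist i j ≠ 1 := fun h => by
      have := (broom_adj hn i j).1 (SimpleGraph.dist_eq_one_iff_adj.1 h)
      omega
    omega
  unfold broomDist
  split_ifs with h h'
  · omega
  · exact h3 h h'.1 h'.2
  · omega

theorem sum_range_sub_index (m : ℕ) : 2 * ∑ i ∈ Finset.range m, (m - i) = m * (m + 1) := by
  have h := Finset.sum_range_reflect (fun i => i + 1) m
  have h' : ∑ i ∈ Finset.range m, (m - i) = ∑ i ∈ Finset.range m, (m - 1 - i + 1) :=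
    Finset.sum_congr rfl fun i hi => by have := Finset.mem_range.1 hi; omega
  rw [h', h]
  clear h h'
  induction m with
  | zero => simp
  | succ m ih => rw [Finset.sum_range_succ, mul_add, ih]; ring

theorem sum_range_sum_range_abs_sub (m : ℕ) :
    3 * (∑ i ∈ Finset.range m, ∑ j ∈ Finset.range m, ((i - j) + (j - i))) + m = m ^ 3 := by
  induction m with
  | zero => simp
  | succ m ih =>
    have h := sum_range_sub_index m
    have h1 : ∑ i ∈ Finset.range m, ((i - m) + (m - i)) = ∑ i ∈ Finset.range m, (m - i) :=
      Finset.sum_congr rfl fun i hi => by have := Finset.mem_range.1 hi; omega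
    have h2 : ∑ i ∈ Finset.range m, ((m - i) + (i - m)) = ∑ i ∈ Finset.range m, (m - i) :=
      Finset.sum_congr rfl fun i hi => by have := Finset.mem_range.1 hi; omega
    simp_rw [Finset.sum_range_succ, Finset.sum_add_distrib (g := fun i => (i - m) + (m - i)),
      h1, h2]
    simp only [Nat.sub_self, add_zero]
    linarith [ih, h, show (m + 1) ^ 3 = m ^ 3 + 3 * (m * (m + 1)) + 1 by ring]

theorem sum_broomDist (m : ℕ) :
    3 * (∑ i ∈ Finset.range (m + 2), ∑ j ∈ Finset.range (m + 2), broomDist (m + 2) i j) + m =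
      m ^ 3 + 6 * (m * (m + 1)) + 12 := by
  have h := sum_range_sub_index m
  have h0 : ∑ i ∈ Finset.range m, ∑ j ∈ Finset.range m, broomDist (m + 2) i j =
      ∑ i ∈ Finset.range m, ∑ j ∈ Finset.range m, ((i - j) + (j - i)) := by
    refine Finset.sum_congr rfl fun i hi => Finset.sum_congr rfl fun j hj => ?_
    have := Finset.mem_range.1 hi
    have := Finset.mem_range.1 hj
    unfold broomDist
    split_ifs <;> omega
  have h1 : ∀ k, m ≤ k → ∑ i ∈ Finset.range m, broomDist (m + 2) i k =
      ∑ i ∈ Finset.range m, (m - i) := fun k hk =>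
    Finset.sum_congr rfl fun i hi => by
      have := Finset.mem_range.1 hi
      unfold broomDist
      split_ifs <;> omega
  have h2 : ∀ k, m ≤ k → ∑ i ∈ Finset.range m, broomDist (m + 2) k i =
      ∑ i ∈ Finset.range m, (m - i) := fun k hk => by
    simp_rw [broomDist_comm (m + 2) k]
    exact h1 k hk
  have h3 := sum_range_sum_range_abs_sub m
  simp_rw [Finset.sum_range_succ, Finset.sum_add_distrib, h0, h1 m le_rfl, h1 (m + 1) (by omega),
    h2 m le_rfl, h2 (m + 1) (by omega)]
  simp [broomDist]
  linarith

theorem muAlpha_broom_lt_pathGraph (hn : 4 ≤ n) {α : ℝ} (hα0 : 0 ≤ α) (hα1 : α < 1) :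
    muAlpha (broom n) α < muAlpha (SimpleGraph.pathGraph n) α := by
  have : Nontrivial (Fin n) := Fin.nontrivial_iff_two_le.2 (by omega)
  obtain ⟨x, hx, hxμ⟩ := exists_pos_energy_eq_muAlpha (broom_connected hn) hα0 hα1
  let p : Fin n := ⟨n - 3, by omega⟩
  let q : Fin n := ⟨n - 2, by omega⟩
  let r : Fin n := ⟨n - 1, by omega⟩
  let e₁ : Fin n ≃ Fin n := Equiv.swap p q
  let e₂ : Fin n ≃ Fin n := (Equiv.swap q r).trans (Equiv.swap p q)
  have he₁ : ∀ i, (e₁ i).val = if i.val = n - 3 then n - 2 else if i.val = n - 2 then n - 3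
      else i.val := by
    intro i
    simp only [e₁, Equiv.swap_apply_def, p, q, Fin.ext_iff]
    split_ifs <;> rfl
  have he₂ : ∀ i, (e₂ i).val = if i.val = n - 3 then n - 2 else if i.val = n - 2 then n - 1
      else if i.val = n - 1 then n - 3 else i.val := by
    intro i
    simp only [e₂, Equiv.trans_apply, Equiv.swap_apply_def, p, q, r, Fin.ext_iff]
    split_ifs <;> simp_all <;> omega
  have hcases : ∀ i : Fin n, (i.val < n - 3 ∧ (e₁ i).val = i.val ∧ (e₂ i).val = i.val) ∨
      (i.val = n - 3 ∧ (e₁ i).val = n - 2 ∧ (e₂ i).val = n - 2) ∨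
      (i.val = n - 2 ∧ (e₁ i).val = n - 3 ∧ (e₂ i).val = n - 1) ∨
      (i.val = n - 1 ∧ (e₁ i).val = n - 1 ∧ (e₂ i).val = n - 3) := by
    intro i
    have hi := i.isLt
    rw [he₁, he₂]
    split_ifs <;> omega
  have hle : ∀ i j : Fin n, 2 * broomDist n i j ≤
      (SimpleGraph.pathGraph n).dist (e₁ i) (e₁ j) +
        (SimpleGraph.pathGraph n).dist (e₂ i) (e₂ j) := by
    intro i j
    have h1 := le_pathGraph_dist (e₁ i) (e₁ j)
    have h2 := le_pathGraph_dist (e₂ i) (e₂ j)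
    generalize (SimpleGraph.pathGraph n).dist (e₁ i) (e₁ j) = d₁ at *
    generalize (SimpleGraph.pathGraph n).dist (e₂ i) (e₂ j) = d₂ at *
    unfold broomDist
    rcases hcases i with ⟨hi, hi₁, hi₂⟩ | ⟨hi, hi₁, hi₂⟩ | ⟨hi, hi₁, hi₂⟩ | ⟨hi, hi₁, hi₂⟩ <;>
    rcases hcases j with ⟨hj, hj₁, hj₂⟩ | ⟨hj, hj₁, hj₂⟩ | ⟨hj, hj₁, hj₂⟩ | ⟨hj, hj₁, hj₂⟩ <;>
    rw [hi₁, hj₁] at h1 <;> rw [hi₂, hj₂] at h2 <;> clear hcases he₁ he₂ hxμ <;>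
    split_ifs <;> omega
  have hlt : 2 * broomDist n (n - 4) (n - 3) <
      (SimpleGraph.pathGraph n).dist (e₁ ⟨n - 4, by omega⟩) (e₁ p) +
        (SimpleGraph.pathGraph n).dist (e₂ ⟨n - 4, by omega⟩) (e₂ p) := by
    refine lt_of_lt_of_le ?_ (add_le_add (le_pathGraph_dist _ _) (le_pathGraph_dist _ _))
    rw [he₁, he₁, he₂, he₂]
    simp only [p]
    unfold broomDist
    split_ifs <;> omega
  have hmul := fun i j => Nat.mul_le_mul_left 2 (broom_dist_le hn i j)
  have hdot : ∀ e : Fin n ≃ Fin n, (x ∘ e.symm) ⬝ᵥ (x ∘ e.symm) = x ⬝ᵥ x := fun e =>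
    Equiv.sum_comp e.symm fun i => x i * x i
  have hpos : 0 < x ⬝ᵥ x :=
    Finset.sum_pos (fun i _ => mul_pos (hx i) (hx i)) Finset.univ_nonempty
  have key : ∀ e : Fin n ≃ Fin n,
      energy (broom n) α x < energy (SimpleGraph.pathGraph n) α (x ∘ e.symm) →
      muAlpha (broom n) α < muAlpha (SimpleGraph.pathGraph n) α := by
    intro e h
    have h' := energy_le_muAlpha (SimpleGraph.pathGraph n) α (x ∘ e.symm)
    rw [hdot] at h'
    exact lt_of_mul_lt_mul_right (hxμ ▸ h.trans_le h') hpos.le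
  exact (energy_lt_or_energy_lt e₁ e₂ hα0 hα1 hx (fun i j => (hmul i j).trans (hle i j))
    ⟨⟨n - 4, by omega⟩, p, (hmul _ _).trans_lt hlt⟩).elim (key e₁) (key e₂)

theorem lt_muAlpha_broom (hn : 4 ≤ n) (α : ℝ) : (n : ℝ) ^ 2 / 4 < muAlpha (broom n) α := by
  have h1 := energy_le_muAlpha (broom n) α (fun _ => 1)
  have h2 : energy (broom n) α (fun _ => 1) = ∑ i, ∑ j, ((broom n).dist i j : ℝ) := by
    simp only [energy, pairWeight]
    refine Finset.sum_congr rfl fun i _ => Finset.sum_congr rfl fun j _ => ?_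
    ring
  have h3 : ((∑ i ∈ Finset.range n, ∑ j ∈ Finset.range n, broomDist n i j : ℕ) : ℝ) ≤
      ∑ i, ∑ j, ((broom n).dist i j : ℝ) := by
    rw [← Fin.sum_univ_eq_sum_range (fun i => ∑ j ∈ Finset.range n, broomDist n i j)]
    simp_rw [← Fin.sum_univ_eq_sum_range (broomDist n _)]
    push_cast
    exact Finset.sum_le_sum fun i _ => Finset.sum_le_sum fun j _ => by
      exact_mod_cast le_broom_dist hn i j
  have h4 : ((fun _ => 1 : Fin n → ℝ) ⬝ᵥ fun _ => 1) = n := by simp [dotProduct]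
  rw [h2, h4] at h1
  obtain ⟨m, rfl⟩ : ∃ m, n = m + 2 := ⟨n - 2, by omega⟩
  have h5 : (3 * ((∑ i ∈ Finset.range (m + 2), ∑ j ∈ Finset.range (m + 2),
      broomDist (m + 2) i j : ℕ) : ℝ) + m) = m ^ 3 + 6 * (m * (m + 1)) + 12 := by
    exact_mod_cast sum_broomDist m
  have hm : (2 : ℝ) ≤ m := by exact_mod_cast (by omega : 2 ≤ m)
  push_cast at *
  refine lt_of_mul_lt_mul_right (a := (m : ℝ) + 2) ?_ (by positivity)
  nlinarith [mul_nonneg (sub_nonneg.2 hm) (sub_nonneg.2 hm),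
    mul_nonneg (mul_nonneg (sub_nonneg.2 hm) (sub_nonneg.2 hm)) (sub_nonneg.2 hm)]

end Broom

section ClawFree

theorem sum_range_min_sub_le (n : ℕ) : 4 * ∑ k ∈ Finset.range n, min k (n - k) ≤ n ^ 2 := by
  induction n using Nat.twoStepInduction with
  | zero => simp
  | one => simp
  | more n ih _ =>
    have h : ∑ k ∈ Finset.range (n + 1), min (k + 1) (n + 2 - (k + 1)) =
        ∑ k ∈ Finset.range (n + 1), (min k (n - k) + 1) :=
      Finset.sum_congr rfl fun k hk => by have := Finset.mem_range.1 hk; omega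
    rw [Finset.sum_range_succ', h, Finset.sum_add_distrib, Finset.sum_range_succ]
    simp only [Finset.sum_const, Finset.card_range, smul_eq_mul]
    have h0 : min n (n - n) = 0 := by omega
    have h0' : min 0 (n + 2 - 0) = 0 := by omega
    rw [h0, h0']
    linarith [show (n + 2) ^ 2 = n ^ 2 + 4 * n + 4 by ring]

theorem sum_range_cycleDist {n i : ℕ} (hi : i ≤ n) :
    ∑ j ∈ Finset.range n, min ((i - j) + (j - i)) (n - ((i - j) + (j - i))) =
      ∑ k ∈ Finset.range n, min k (n - k) := by
  obtain ⟨m, rfl⟩ : ∃ m, n = i + m := ⟨n - i, by omega⟩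
  rw [Finset.sum_range_add, add_comm i m, Finset.sum_range_add, add_comm]
  congr 1
  · exact Finset.sum_congr rfl fun k hk => by omega
  · exact Finset.sum_congr rfl fun k hk => by have := Finset.mem_range.1 hk; omega

theorem muAlpha_le_of_transmission_le {W : Type*} [Fintype W] [DecidableEq W] [Nontrivial W]
    {G : SimpleGraph W} (hG : G.Connected) {α : ℝ} (hα0 : 0 ≤ α) (hα1 : α < 1) {c : ℝ}
    (h : ∀ u, transmission G u ≤ c) : muAlpha G α ≤ c := by
  obtain ⟨x, hx, hxμ⟩ := exists_pos_energy_eq_muAlpha hG hα0 hα1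
  have hpos : 0 < x ⬝ᵥ x :=
    Finset.sum_pos (fun i _ => mul_pos (hx i) (hx i)) Finset.univ_nonempty
  refine le_of_mul_le_mul_right (hxμ ▸ ?_) hpos
  have hswap : ∑ u, ∑ v, (G.dist u v : ℝ) * x v ^ 2 = ∑ u, ∑ v, (G.dist u v : ℝ) * x u ^ 2 := by
    rw [Finset.sum_comm]
    simp_rw [SimpleGraph.dist_comm]
  calc energy G α x ≤ ∑ u, ∑ v, (G.dist u v : ℝ) * ((x u ^ 2 + x v ^ 2) / 2) :=
        Finset.sum_le_sum fun u _ => Finset.sum_le_sum fun v _ =>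
          mul_le_mul_of_nonneg_left (pairWeight_le hα1 x u v) (Nat.cast_nonneg _)
    _ = (∑ u, ∑ v, (G.dist u v : ℝ) * x u ^ 2 + ∑ u, ∑ v, (G.dist u v : ℝ) * x v ^ 2) / 2 := by
        simp_rw [← Finset.sum_add_distrib, Finset.sum_div]
        exact Finset.sum_congr rfl fun u _ => Finset.sum_congr rfl fun v _ => by ring
    _ = ∑ u, transmission G u * x u ^ 2 := by
        rw [hswap, add_self_div_two]
        simp_rw [transmission, Finset.sum_mul]
    _ ≤ ∑ u, c * (x u * x u) := Finset.sum_le_sum fun u _ => by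
        rw [← sq]
        exact mul_le_mul_of_nonneg_right (h u) (sq_nonneg _)
    _ = c * (x ⬝ᵥ x) := by rw [← Finset.mul_sum, dotProduct]

variable {n : ℕ} {H : SimpleGraph (Fin n)}

/-- A claw-free graph properly containing the path `0 - 1 - ⋯ - (n-1)` contains the edge closing
this path to a cycle. -/
theorem adj_of_pathGraph_lt (hle : SimpleGraph.pathGraph n ≤ H) (hne : SimpleGraph.pathGraph n ≠ H)
    (hc : ¬ HasClaw H) {i j : Fin n} (hi : i.val = 0) (hj : j.val = n - 1) : H.Adj i j := by
  have hchain : ∀ a b : Fin n, a.val + 1 = b.val → H.Adj a b := fun a b h =>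
    hle (SimpleGraph.pathGraph_adj.2 (Or.inl h))
  obtain ⟨a, b, hab, hlt⟩ : ∃ a b : Fin n, H.Adj a b ∧ a.val + 1 < b.val := by
    by_contra! h
    refine hne (le_antisymm hle fun a b hab => SimpleGraph.pathGraph_adj.2 ?_)
    have h1 := h a b hab
    have h2 := h b a hab.symm
    have h3 : a.val ≠ b.val := fun e => hab.ne (Fin.ext e)
    omega
  have ha := a.isLt
  have hb := b.isLt
  have ha0 : a.val = 0 := by
    by_contra h0
    refine hc ⟨a, ⟨a.val - 1, by omega⟩, ⟨a.val + 1, by omega⟩, b,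
      (hchain _ _ (by simp only; omega)).symm, hchain _ _ rfl, hab, ?_⟩
    simp only [ne_eq, Fin.ext_iff]
    omega
  have hbn : b.val = n - 1 := by
    by_contra h0
    refine hc ⟨b, ⟨b.val - 1, by omega⟩, ⟨b.val + 1, by omega⟩, a,
      (hchain _ _ (by simp only; omega)).symm, hchain _ _ rfl, hab.symm, ?_⟩
    simp only [ne_eq, Fin.ext_iff]
    omega
  rwa [Fin.ext (hi.trans ha0.symm), Fin.ext (hj.trans hbn.symm)]

theorem dist_le_of_pathGraph_lt (hle : SimpleGraph.pathGraph n ≤ H)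
    (hne : SimpleGraph.pathGraph n ≠ H) (hc : ¬ HasClaw H) (hconn : H.Connected) (i j : Fin n) :
    H.dist i j ≤
      min ((i.val - j.val) + (j.val - i.val)) (n - ((i.val - j.val) + (j.val - i.val))) := by
  wlog hij : i ≤ j generalizing i j
  · rw [SimpleGraph.dist_comm, add_comm]
    exact this j i (le_of_not_ge hij)
  have hchain : ∀ a b : Fin n, a.val + 1 = b.val → b.val ≤ n → H.Adj a b := fun a b h _ =>
    hle (SimpleGraph.pathGraph_adj.2 (Or.inl h))
  have hval : i.val ≤ j.val := hij
  have hj := j.isLt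
  let s : Fin n := ⟨0, by omega⟩
  let t : Fin n := ⟨n - 1, by omega⟩
  have h1 := dist_le_of_chain hchain hij hj.le
  have h2 : H.dist s i ≤ i.val - 0 := dist_le_of_chain hchain (Nat.zero_le _) (by omega)
  have h3 : H.dist j t ≤ n - 1 - j.val :=
    dist_le_of_chain hchain (Nat.le_sub_one_of_lt hj) (Nat.sub_le _ _)
  have h4 : H.dist s t = 1 :=
    SimpleGraph.dist_eq_one_iff_adj.2 (adj_of_pathGraph_lt hle hne hc rfl rfl)
  have h5 := hconn.dist_triangle (u := i) (v := s) (w := j)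
  have h6 := hconn.dist_triangle (u := s) (v := t) (w := j)
  rw [SimpleGraph.dist_comm] at h2 h3
  omega

theorem muAlpha_le_of_pathGraph_lt (hn : 4 ≤ n) (hle : SimpleGraph.pathGraph n ≤ H)
    (hne : SimpleGraph.pathGraph n ≠ H) (hc : ¬ HasClaw H) (hconn : H.Connected) {α : ℝ}
    (hα0 : 0 ≤ α) (hα1 : α < 1) : muAlpha H α ≤ (n : ℝ) ^ 2 / 4 := by
  have : Nontrivial (Fin n) := Fin.nontrivial_iff_two_le.2 (by omega)
  refine muAlpha_le_of_transmission_le hconn hα0 hα1 fun i => ?_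
  have h : 4 * ∑ j, H.dist i j ≤ n ^ 2 := by
    refine le_trans (Nat.mul_le_mul_left 4 ?_) (sum_range_min_sub_le n)
    rw [← sum_range_cycleDist i.isLt.le, ← Fin.sum_univ_eq_sum_range
      (fun j => min ((i.val - j) + (j - i.val)) (n - ((i.val - j) + (j - i.val))))]
    exact Finset.sum_le_sum fun j _ => dist_le_of_pathGraph_lt hle hne hc hconn i j
  have h' : (4 * ∑ j, H.dist i j : ℝ) ≤ n ^ 2 := by exact_mod_cast h
  rw [transmission]
  push_cast at h'
  linarith

theorem exists_iso_pathGraph_le {W : Type*} [Fintype W] [Nontrivial W] {n : ℕ}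
    (hcard : Fintype.card W = n) {G : SimpleGraph W} (hG : G.Connected) (hc : ¬ HasClaw G) :
    ∃ H : SimpleGraph (Fin n), SimpleGraph.pathGraph n ≤ H ∧ Nonempty (H ≃g G) := by
  classical
  obtain ⟨T, hTG, hT⟩ := hG.exists_isTree_le
  obtain ⟨u, hu⟩ := hT.exists_vert_degree_one_of_nontrivial
  obtain ⟨w, -, hw⟩ := SimpleGraph.degree_eq_one_iff_existsUnique_adj.1 hu
  have htail : IsTail T u Finset.univ :=
    { connected := hT.connected
      mem := Finset.mem_univ u
      root := fun y _ z _ hy hz => (hw y hy).trans (hw z hz).symm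
      degree := fun v _ p q r hp hq hr => by
        by_contra! h
        exact hc ⟨v, p, q, r, hTG hp, hTG hq, hTG hr, h⟩
      pendant := fun w hw => absurd (Finset.mem_univ w) hw }
  obtain ⟨e⟩ := nonempty_iso_pathGraph hcard htail
  exact ⟨G.comap e.symm.toEquiv, fun a b hab => hTG (e.symm.map_adj_iff.2 hab),
    ⟨SimpleGraph.Iso.comap e.symm.toEquiv G⟩⟩

theorem HasClaw.map {W W' : Type*} {G : SimpleGraph W} {H : SimpleGraph W'} (e : G ≃g H)
    (h : HasClaw G) : HasClaw H := by
  obtain ⟨v, x, y, z, hx, hy, hz, hxy, hxz, hyz⟩ := h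
  exact ⟨e v, e x, e y, e z, e.map_adj_iff.2 hx, e.map_adj_iff.2 hy, e.map_adj_iff.2 hz,
    e.injective.ne hxy, e.injective.ne hxz, e.injective.ne hyz⟩

theorem muAlpha_lt_broom_of_not_hasClaw {W : Type*} [Fintype W] [DecidableEq W] {n : ℕ}
    (hn : 4 ≤ n) (hcard : Fintype.card W = n) {G : SimpleGraph W} (hG : G.Connected)
    (hnp : ¬ Nonempty (G ≃g SimpleGraph.pathGraph n)) (hc : ¬ HasClaw G) {α : ℝ}
    (hα0 : 0 ≤ α) (hα1 : α < 1) : muAlpha G α < muAlpha (broom n) α := by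
  have : Nontrivial W := Fintype.one_lt_card_iff_nontrivial.1 (by omega)
  obtain ⟨H, hle, ⟨e⟩⟩ := exists_iso_pathGraph_le hcard hG hc
  rw [← muAlpha_congr e]
  refine (muAlpha_le_of_pathGraph_lt hn hle ?_ (fun h => hc (h.map e)) ?_ hα0 hα1).trans_lt
    (lt_muAlpha_broom hn α)
  · rintro rfl
    exact hnp ⟨e.symm⟩
  · exact e.connected_iff.2 hG

end ClawFree

theorem muAlpha_le_broom_of_hasClaw {W : Type*} [Fintype W] [DecidableEq W] {n : ℕ}
    (hn : 4 ≤ n) (hcard : Fintype.card W = n) {G : SimpleGraph W} (hG : G.Connected)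
    (hc : HasClaw G) {α : ℝ} (hα0 : 0 ≤ α) (hα1 : α < 1) :
    muAlpha G α ≤ muAlpha (broom n) α ∧
      (muAlpha G α = muAlpha (broom n) α → Nonempty (G ≃g broom n)) := by
  have : Nontrivial W := Fintype.one_lt_card_iff_nontrivial.1 (by omega)
  obtain ⟨x, hx, hxμ⟩ := exists_pos_energy_eq_muAlpha hG hα0 hα1
  have hpos : 0 < x ⬝ᵥ x :=
    Finset.sum_pos (fun i _ => mul_pos (hx i) (hx i)) Finset.univ_nonempty
  obtain ⟨H, hH⟩ := exists_isExtremal hG hc α x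
  obtain ⟨e⟩ := hH.nonempty_iso_broom hn hcard hα0 hα1 hx
  have h1 := hH.energy_le G hG hc
  have h2 := energy_le_muAlpha H α x
  rw [muAlpha_congr e] at h2
  refine ⟨le_of_mul_le_mul_right (hxμ ▸ h1.trans h2) hpos, fun heq => ?_⟩
  have h3 : energy H α x ≤ energy G α x := by rwa [hxμ, heq]
  have hGx : IsExtremal G α x := ⟨hG, hc, fun K hK hKc => (hH.energy_le K hK hKc).trans h3⟩
  exact hGx.nonempty_iso_broom hn hcard hα0 hα1 hx

/-- among connected graphs on `n ≥ 4` vertices other than the path,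
`B_{n,3}` uniquely maximizes the distance α-spectral radius, and
`μ_α(B_{n,3}) < μ_α(P_n)`. -/
theorem muAlpha_le_broom (n : ℕ) (hn : 4 ≤ n) (G : SimpleGraph V)
    (hcard : Fintype.card V = n) (hconn : G.Connected)
    (hnp : ¬ Nonempty (G ≃g SimpleGraph.pathGraph n))
    (α : ℝ) (hα0 : 0 ≤ α) (hα1 : α < 1) :
    muAlpha G α ≤ muAlpha (broom n) α ∧
      muAlpha (broom n) α < muAlpha (SimpleGraph.pathGraph n) α ∧
      (muAlpha G α = muAlpha (broom n) α ↔ Nonempty (G ≃g broom n)) := by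
  have hlt := muAlpha_broom_lt_pathGraph hn hα0 hα1
  by_cases hc : HasClaw G
  · obtain ⟨hle, heq⟩ := muAlpha_le_broom_of_hasClaw hn hcard hconn hc hα0 hα1
    exact ⟨hle, hlt, heq, fun ⟨e⟩ => muAlpha_congr e α⟩
  · have h := muAlpha_lt_broom_of_not_hasClaw hn hcard hconn hnp hc hα0 hα1
    exact ⟨h.le, hlt, fun heq => absurd heq h.ne, fun ⟨e⟩ => muAlpha_congr e α⟩

end DistAlpha
end
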